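/- Under the hypotheses of the WCGA recovery theorem for uniformly bounded Riesz systems with 2 < p < ∞ (D_N a uniformly bounded Riesz system with constants R_1, R_2; u := ⌈(1 + c(2R_1^{−1})²(ln(2R_1^{−1}v))) v⌉ ≤ N; ξ^1,…,ξ^m the points with m ≤ C u^{p/2}(log N)² provided there), the WCGA residual satisfies ‖f_u‖_{L_p(Ω,μ)} ≤ C' σ_v(f_0, D_N)_{L_p(Ω,μ_ξ)}, where C' is a positive absolute constant and μ_ξ := (μ + μ_m)/2 = (1/2)μ + (1/(2m)) Σ_{j=1}^m δ_{ξ^j}. -/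

import Mathlib

open MeasureTheory Finset
open scoped ENNReal NNReal BigOperators

noncomputable section

attribute [local instance] Classical.propDecidable

namespace SamplingRecovery

/-- The `L_p(μ)` norm of a complex-valued function, `1 ≤ p < ∞`. -/
def lpNorm {X : Type*} [MeasurableSpace X] (μ : Measure X) (p : ℝ) (f : X → ℂ) : ℝ :=
  (∫ x, ‖f x‖ ^ p ∂μ) ^ (1 / p)

/-- The discrete `L_p(Ω_m, μ_m)` norm associated with sample points `ξ`. -/
def dNorm {X : Type*} {m : ℕ} (ξ : Fin m → X) (p : ℝ) (f : X → ℂ) : ℝ :=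
  ((m : ℝ)⁻¹ * ∑ j, ‖f (ξ j)‖ ^ p) ^ (1 / p)

/-- The uniform norm of a function. -/
def supNorm {X : Type*} (f : X → ℂ) : ℝ := ⨆ x, ‖f x‖

/-- `Σ_v(D)`: the set of all `v`-term linear combinations with respect to the system `g`. -/
def SigmaSet {X ι : Type*} (g : ι → X → ℂ) (v : ℕ) : Set (X → ℂ) :=
  {f | ∃ (B : Finset ι) (c : ι → ℂ), B.card ≤ v ∧ f = fun x => ∑ i ∈ B, c i * g i x}

/-- `Σ_v` restricted to indices in a finite set `T`. -/
def SigmaSetOn {X ι : Type*} (g : ι → X → ℂ) (T : Finset ι) (v : ℕ) : Set (X → ℂ) :=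
  {f | ∃ (B : Finset ι) (c : ι → ℂ), B ⊆ T ∧ B.card ≤ v ∧ f = fun x => ∑ i ∈ B, c i * g i x}

/-- `σ_v(f, D)_X`: the best `v`-term approximation error of `f` with respect to the
system `g`, measured in the (semi)norm `nrm`. -/
def sigmaErr {X ι : Type*} (nrm : (X → ℂ) → ℝ) (g : ι → X → ℂ) (v : ℕ) (f : X → ℂ) : ℝ :=
  sInf ((fun h => nrm (f - h)) '' SigmaSet g v)

/-- `σ_v(f, D)` with the system restricted to indices in `T`. -/
def sigmaErrOn {X ι : Type*} (nrm : (X → ℂ) → ℝ) (g : ι → X → ℂ) (T : Finset ι)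
    (v : ℕ) (f : X → ℂ) : ℝ :=
  sInf ((fun h => nrm (f - h)) '' SigmaSetOn g T v)

/-- The `(v,S)`-incoherence property with parameters `V > 0` and `r > 0` in the
(semi)norm `nrm`. -/
def Incoherent {X ι : Type*} (g : ι → X → ℂ) (v S : ℕ) (V r : ℝ)
    (nrm : (X → ℂ) → ℝ) : Prop :=
  ∀ (A B : Finset ι), A ⊆ B → A.card ≤ v → B.card ≤ S →
    ∀ c : ι → ℂ,
      ∑ i ∈ A, ‖c i‖ ≤ V * (A.card : ℝ) ^ r * nrm (fun x => ∑ i ∈ B, c i * g i x)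

/-- `(v,S)`-unconditionality with parameter `U` in the (semi)norm `nrm`. -/
def Unconditional {X ι : Type*} (g : ι → X → ℂ) (v S : ℕ) (U : ℝ)
    (nrm : (X → ℂ) → ℝ) : Prop :=
  ∀ (A B : Finset ι), A ⊆ B → A.card ≤ v → B.card ≤ S →
    ∀ c : ι → ℂ,
      nrm (fun x => ∑ i ∈ A, c i * g i x) ≤ U * nrm (fun x => ∑ i ∈ B, c i * g i x)

/-- The points `ξ` provide `L_p`-universal sampling discretization for the collection
`X_u(D_N)` of `u`-term subspaces generated by the system `g`. -/
def USD {X : Type*} [MeasurableSpace X] (μ : Measure X) (p : ℝ) {ι : Type*} {m : ℕ}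
    (g : ι → X → ℂ) (u : ℕ) (ξ : Fin m → X) : Prop :=
  ∀ f ∈ SigmaSet g u,
    (1 / 2 : ℝ) * (∫ x, ‖f x‖ ^ p ∂μ) ≤ (m : ℝ)⁻¹ * ∑ j, ‖f (ξ j)‖ ^ p ∧
    (m : ℝ)⁻¹ * ∑ j, ‖f (ξ j)‖ ^ p ≤ (3 / 2 : ℝ) * (∫ x, ‖f x‖ ^ p ∂μ)

/-- The measure `μ_ξ = (1/2) μ + (1/(2m)) ∑_j δ_{ξ^j}`. -/
def sampleMeasure {X : Type*} [MeasurableSpace X] (μ : Measure X) {m : ℕ}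
    (ξ : Fin m → X) : Measure X :=
  (1 / 2 : ℝ≥0∞) • μ + ((2 * m : ℝ≥0∞))⁻¹ • ∑ j, Measure.dirac (ξ j)

/-- A realization of the Weak Chebyshev Greedy Algorithm with weakness parameter `t`
applied to `f0` with respect to the system `g`, in the space with (semi)norm `nrm`:
`G k` is the approximant after `k` iterations (`f_k = f0 - G k` is the residual),
`φ k` the element of the system chosen at step `k+1`.  At each step a norming
functional `F` of the residual is used (a linear functional of norm `≤ 1` with
`F(f_k) = ‖f_k‖`), the new element `g (φ k)` satisfies the weakness condition
`|F(g (φ k))| ≥ t ⬝ sup_i |F(g i)|`, and `G (k+1)` is a best approximant to `f0`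
from the span of the chosen elements. -/
def IsWCGA {X ι : Type*} (g : ι → X → ℂ) (nrm : (X → ℂ) → ℝ) (t : ℝ)
    (f0 : X → ℂ) (φ : ℕ → ι) (G : ℕ → X → ℂ) : Prop :=
  G 0 = 0 ∧
  ∀ k : ℕ,
    (∃ F : (X → ℂ) →ₗ[ℂ] ℂ,
      (∀ h, ‖F h‖ ≤ nrm h) ∧
      F (f0 - G k) = ((nrm (f0 - G k) : ℝ) : ℂ) ∧
      ∀ i, t * ‖F (g i)‖ ≤ ‖F (g (φ k))‖) ∧
    G (k + 1) ∈ Submodule.span ℂ ((fun j => g (φ j)) '' Set.Iic k) ∧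
    ∀ h ∈ Submodule.span ℂ ((fun j => g (φ j)) '' Set.Iic k),
      nrm (f0 - G (k + 1)) ≤ nrm (f0 - h)

/-- The dyadic shell `{k ∈ ℤ^d : [2^{j-1}] ≤ ‖k‖_∞ < 2^j}` as a finite set. -/
def shell (d j : ℕ) : Finset (Fin d → ℤ) :=
  (Finset.Icc (fun _ => -(2 ^ j : ℤ)) fun _ => (2 ^ j : ℤ)).filter
    fun k => (if j = 0 then (0 : ℝ) else (2 : ℝ) ^ (j - 1)) ≤ ‖k‖ ∧ ‖k‖ < (2 : ℝ) ^ j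

/-- The discrete ball `{k ∈ ℤ^d : ‖k‖_∞ < n}` as a finite set. -/
def lball (d n : ℕ) : Finset (Fin d → ℤ) :=
  (Finset.Icc (fun _ => -(n : ℤ)) fun _ => (n : ℤ)).filter fun k => ‖k‖ < (n : ℝ)

/-- The class `A^r_β(Ψ)`: functions admitting an absolutely convergent expansion
`f = ∑_k a_k ψ_k` with `(∑_{[2^{j-1}] ≤ ‖k‖_∞ < 2^j} |a_k|^β)^{1/β} ≤ 2^{-rj}` for all `j`. -/
def ArClass {X : Type*} {d : ℕ} (ψ : (Fin d → ℤ) → X → ℂ) (β r : ℝ) : Set (X → ℂ) :=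
  {f | ∃ a : (Fin d → ℤ) → ℂ,
    Summable (fun k => ‖a k‖) ∧
    (∀ x, HasSum (fun k => a k * ψ k x) (f x)) ∧
    ∀ j : ℕ, (∑ k ∈ shell d j, ‖a k‖ ^ β) ^ (1 / β) ≤ (2 : ℝ) ^ (-(r * j))}

/-- `ϱ_m^o(F, X)`: the optimal sampling recovery error of a class `F` from `m` point
values, measured in the (semi)norm `nrm`; the recovery maps `M` are arbitrary. -/
def optRecovery {X : Type*} (F : Set (X → ℂ)) (m : ℕ) (nrm : (X → ℂ) → ℝ) : ℝ :=
  ⨅ (ξ : Fin m → X), ⨅ (M : (Fin m → ℂ) → X → ℂ),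
    ⨆ f ∈ F, nrm (f - M fun j => f (ξ j))

/-- The Kolmogorov width `d_n(F, E)` of a set `F` in a space with (semi)norm `nrm`. -/
def kWidth {E : Type*} [AddCommGroup E] [Module ℂ E] (nrm : E → ℝ) (F : Set E)
    (n : ℕ) : ℝ :=
  ⨅ u : Fin n → E, ⨆ f ∈ F, ⨅ c : Fin n → ℂ, nrm (f - ∑ i, c i • u i)

/-- Normalized Lebesgue measure on the cube `[0, 2π)^d`, representing `𝕋^d`. -/
def torusMeasure (d : ℕ) : Measure (Fin d → ℝ) :=
  (ENNReal.ofReal ((2 * Real.pi) ^ d))⁻¹ •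
    volume.restrict (Set.univ.pi fun _ => Set.Ico (0 : ℝ) (2 * Real.pi))

/-- The trigonometric monomial `e^{i(k,x)}` on `𝕋^d`. -/
def trig {d : ℕ} (k : Fin d → ℤ) (x : Fin d → ℝ) : ℂ :=
  Complex.exp (Complex.I * ((∑ j, (k j : ℝ) * x j : ℝ) : ℂ))

end SamplingRecovery

open SamplingRecovery

/-- Number of iterations `u = ⌈(1 + c (2V)² ln(2Vv)) v⌉` with `V = R₁⁻¹`. -/
def uRiesz (c R1 : ℝ) (v : ℕ) : ℕ :=
  ⌈(1 + c * (2 * R1⁻¹) ^ 2 * Real.log (2 * R1⁻¹ * v)) * (v : ℝ)⌉₊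


namespace WR

lemma scalar_ineq {p : ℝ} (hp : 2 < p) (a b : ℂ) :
    ‖a + b‖ ^ p + ‖a - b‖ ^ p ≤ 2 * (‖a‖ ^ 2 + (p + 1) ^ 2 * ‖b‖ ^ 2) ^ (p / 2) := by
  have hq : 1 ≤ p / 2 := by linarith
  have key : ∀ z : ℂ, ‖z‖ ^ p = (‖z‖ ^ 2) ^ (p / 2) := by
    intro z
    rw [← Real.rpow_natCast, ← Real.rpow_mul (norm_nonneg z)]
    congr 1; push_cast; ring
  rw [key, key]
  set x := ‖a‖ with hx
  set y := ‖b‖ with hy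
  have hx0 : 0 ≤ x := norm_nonneg a
  have hy0 : 0 ≤ y := norm_nonneg b
  by_cases hc : x ≤ p * y
  · have h1 : ‖a + b‖ ≤ (p + 1) * y := by
      have := norm_add_le a b; nlinarith
    have h2 : ‖a - b‖ ≤ (p + 1) * y := by
      have := norm_sub_le a b; nlinarith
    have h3 : (‖a + b‖ ^ 2) ^ (p / 2) ≤ (x ^ 2 + (p + 1) ^ 2 * y ^ 2) ^ (p / 2) := by
      apply Real.rpow_le_rpow (by positivity) _ (by linarith)
      have := pow_le_pow_left₀ (norm_nonneg _) h1 2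
      nlinarith [sq_nonneg x]
    have h4 : (‖a - b‖ ^ 2) ^ (p / 2) ≤ (x ^ 2 + (p + 1) ^ 2 * y ^ 2) ^ (p / 2) := by
      apply Real.rpow_le_rpow (by positivity) _ (by linarith)
      have := pow_le_pow_left₀ (norm_nonneg _) h2 2
      nlinarith [sq_nonneg x]
    linarith
  · push Not at hc
    have hxpos : 0 < x := lt_of_le_of_lt (by positivity) hc
    set D := 2 * inner ℝ a b with hD
    have e1 : ‖a + b‖ ^ 2 = x ^ 2 + D + y ^ 2 := norm_add_sq_real a b
    have e2 : ‖a - b‖ ^ 2 = x ^ 2 - D + y ^ 2 := norm_sub_sq_real a b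
    have hDb : |D| ≤ 2 * (x * y) := by
      rw [hD, abs_mul, abs_two]
      have := abs_real_inner_le_norm a b
      linarith
    set A := x ^ 2 with hA
    have hApos : 0 < A := by positivity
    set q := p / 2 with hqd
    have hDsq : D ^ 2 ≤ 4 * (A * y ^ 2) := by
      have := pow_le_pow_left₀ (abs_nonneg _) hDb 2
      rw [sq_abs] at this
      calc D ^ 2 ≤ _ := this
        _ = _ := by rw [hA]; ring
    have gen : ∀ s : ℝ, 0 ≤ A + s → (A + s) ^ q ≤ A ^ q * Real.exp (q * (s / A)) := by
      intro s hs
      have : A + s = A * (1 + s / A) := by field_simp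
      have h1 : 0 ≤ 1 + s / A := by
        rw [this] at hs
        exact nonneg_of_mul_nonneg_right hs hApos
      rw [this, Real.mul_rpow hApos.le h1]
      apply mul_le_mul_of_nonneg_left _ (by positivity)
      have h2 : 1 + s / A ≤ Real.exp (s / A) := by
        have := Real.add_one_le_exp (s / A); linarith
      calc (1 + s / A) ^ q ≤ (Real.exp (s / A)) ^ q := Real.rpow_le_rpow h1 h2 (by linarith)
        _ = _ := by rw [← Real.exp_mul, mul_comm]
    have g1 := gen (D + y ^ 2) (by have : 0 ≤ ‖a + b‖ ^ 2 := by positivity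
                                   linarith)
    have g2 := gen (-D + y ^ 2) (by have : 0 ≤ ‖a - b‖ ^ 2 := by positivity
                                    linarith)
    rw [e1, e2, show A + D + y ^ 2 = A + (D + y ^ 2) by ring,
      show A - D + y ^ 2 = A + (-D + y ^ 2) by ring]
    set w := y ^ 2 / A with hw
    have hw0 : 0 ≤ w := by positivity
    have ee1 : Real.exp (q * ((D + y ^ 2) / A)) = Real.exp (q * w) * Real.exp (q * D / A) := by
      rw [← Real.exp_add]; congr 1; rw [hw]; field_simp; ring
    have ee2 : Real.exp (q * ((-D + y ^ 2) / A)) = Real.exp (q * w) * Real.exp (-(q * D / A)) := by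
      rw [← Real.exp_add]; congr 1; rw [hw]; field_simp; ring
    have hcosh := Real.cosh_le_exp_half_sq (q * D / A)
    rw [Real.cosh_eq] at hcosh
    have hexp2 : (q * D / A) ^ 2 / 2 ≤ 2 * q ^ 2 * w := by
      have : (q * D / A) ^ 2 / 2 = q ^ 2 / (2 * A ^ 2) * D ^ 2 := by field_simp
      rw [this]
      calc q ^ 2 / (2 * A ^ 2) * D ^ 2 ≤ q ^ 2 / (2 * A ^ 2) * (4 * (A * y ^ 2)) := by gcongr
        _ = _ := by rw [hw]; field_simp; ring
    have hwp : p ^ 2 * w ≤ 1 := by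
      rw [hw, ← mul_div_assoc, div_le_one hApos, hA, ← mul_pow]
      exact pow_le_pow_left₀ (by positivity) hc.le 2
    have hpq : p = 2 * q := by rw [hqd]; ring
    set X := q * w + 2 * q ^ 2 * w with hX
    have hX0 : 0 ≤ X := by positivity
    have hX1 : X ≤ 1 := by
      have e : p ^ 2 * w - X = (q * w) * (2 * q - 1) := by rw [hX, hqd]; ring
      have : 0 ≤ (q * w) * (2 * q - 1) := by
        apply mul_nonneg (mul_nonneg (by linarith) hw0); linarith
      linarith
    have hexpX : Real.exp X ≤ 1 + 2 * X := by
      have := Real.abs_exp_sub_one_sub_id_le (x := X) (by rw [abs_of_nonneg hX0]; exact hX1)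
      have := (abs_le.mp this).2
      nlinarith
    have hfin : Real.exp X ≤ (1 + (p + 1) ^ 2 * w) ^ q := by
      have h1 : 1 + 2 * X ≤ 1 + (p + 1) ^ 2 * w := by
        have e : (1 + (p + 1) ^ 2 * w) - (1 + 2 * X) = (p + 1) * w := by rw [hX, hqd]; ring
        have : 0 ≤ (p + 1) * w := mul_nonneg (by linarith) hw0
        linarith
      calc Real.exp X ≤ _ := hexpX
        _ ≤ _ := h1
        _ ≤ _ := Real.self_le_rpow_of_one_le (by linarith [mul_nonneg (sq_nonneg (p+1)) hw0]) hq
    have hsum : Real.exp (q * w) * Real.exp (q * D / A) + Real.exp (q * w) * Real.exp (-(q * D / A))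
        ≤ 2 * Real.exp X := by
      have : Real.exp X = Real.exp (q * w) * Real.exp (2 * q ^ 2 * w) := by
        rw [← Real.exp_add]
      rw [this]
      have h3 : Real.exp ((q * D / A) ^ 2 / 2) ≤ Real.exp (2 * q ^ 2 * w) := Real.exp_le_exp.mpr hexp2
      nlinarith [Real.exp_pos (q * w)]
    have hlast : (A + (p + 1) ^ 2 * y ^ 2) ^ q = A ^ q * (1 + (p + 1) ^ 2 * w) ^ q := by
      rw [← Real.mul_rpow hApos.le (by positivity)]
      congr 1; rw [hw]; field_simp
    rw [hlast]
    rw [ee1] at g1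
    rw [ee2] at g2
    have hAq : 0 < A ^ q := by positivity
    calc _ ≤ A ^ q * (Real.exp (q * w) * Real.exp (q * D / A) + Real.exp (q * w) * Real.exp (-(q * D / A))) := by linarith
      _ ≤ A ^ q * (2 * Real.exp X) := by gcongr
      _ ≤ A ^ q * (2 * (1 + (p + 1) ^ 2 * w) ^ q) := by gcongr
      _ = _ := by ring

section dn
variable {X : Type*} {m : ℕ} (ξ : Fin m → X) {p : ℝ}

lemma dNorm_nonneg (f : X → ℂ) : 0 ≤ dNorm ξ p f := by
  unfold dNorm; positivity

lemma dNorm_eq (f : X → ℂ) :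
    dNorm ξ p f = ((m : ℝ)⁻¹) ^ (1 / p) * (∑ j, ‖f (ξ j)‖ ^ p) ^ (1 / p) := by
  unfold dNorm
  rw [Real.mul_rpow (by positivity) (by positivity)]

lemma dNorm_pow (hp : 0 < p) (f : X → ℂ) :
    dNorm ξ p f ^ p = (m : ℝ)⁻¹ * ∑ j, ‖f (ξ j)‖ ^ p := by
  unfold dNorm
  rw [← Real.rpow_mul (by positivity), one_div_mul_cancel hp.ne', Real.rpow_one]

lemma dNorm_add (hp : 1 ≤ p) (f h : X → ℂ) :
    dNorm ξ p (f + h) ≤ dNorm ξ p f + dNorm ξ p h := by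
  rw [dNorm_eq, dNorm_eq, dNorm_eq, ← mul_add]
  apply mul_le_mul_of_nonneg_left _ (by positivity)
  refine le_trans ?_ (Real.Lp_add_le_of_nonneg (s := Finset.univ) (f := fun j => ‖f (ξ j)‖)
    (g := fun j => ‖h (ξ j)‖) hp (fun _ _ => norm_nonneg _) (fun _ _ => norm_nonneg _))
  apply Real.rpow_le_rpow (by positivity) _ (by positivity)
  apply Finset.sum_le_sum
  intro j _
  apply Real.rpow_le_rpow (norm_nonneg _) _ (by linarith)
  exact norm_add_le _ _

lemma dNorm_smul (hp : 0 < p) (c : ℂ) (f : X → ℂ) :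
    dNorm ξ p (c • f) = ‖c‖ * dNorm ξ p f := by
  unfold dNorm
  have : ∀ j, ‖(c • f) (ξ j)‖ ^ p = ‖c‖ ^ p * ‖f (ξ j)‖ ^ p := by
    intro j
    rw [Pi.smul_apply, norm_smul, Real.mul_rpow (norm_nonneg _) (norm_nonneg _)]
  simp only [this]
  rw [← Finset.mul_sum, mul_left_comm, Real.mul_rpow (by positivity) (by positivity),
    ← Real.rpow_mul (norm_nonneg _), mul_one_div_cancel hp.ne', Real.rpow_one]

lemma dNorm_smooth (hp : 2 < p) (x y : X → ℂ) (hx : 0 < dNorm ξ p x) :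
    dNorm ξ p (x + y) + dNorm ξ p (x - y) ≤
      2 * dNorm ξ p x + (p + 1) ^ 2 * dNorm ξ p y ^ 2 / dNorm ξ p x := by
  have hp0 : 0 < p := by linarith
  set a := dNorm ξ p (x + y) with ha
  set b := dNorm ξ p (x - y) with hb
  set S := dNorm ξ p x with hS
  set T := dNorm ξ p y with hT
  have ha0 : 0 ≤ a := dNorm_nonneg ξ _
  have hb0 : 0 ≤ b := dNorm_nonneg ξ _
  have hT0 : 0 ≤ T := dNorm_nonneg ξ _
  -- mean power
  have h1 : ((a + b) / 2) ^ p ≤ (a ^ p + b ^ p) / 2 := by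
    have hcv : ConvexOn ℝ (Set.Ici 0) fun x : ℝ => x ^ p := convexOn_rpow (by linarith)
    have := hcv.2 ha0 hb0 (by norm_num : (0:ℝ) ≤ 1/2) (by norm_num : (0:ℝ) ≤ 1/2) (by norm_num)
    simp only [smul_eq_mul] at this
    calc ((a + b) / 2) ^ p = (1/2 * a + 1/2 * b) ^ p := by congr 1; ring
      _ ≤ _ := this
      _ = _ := by ring
  have h2 : (a ^ p + b ^ p) / 2 ≤
      (m : ℝ)⁻¹ * ∑ j, (‖x (ξ j)‖ ^ 2 + (p + 1) ^ 2 * ‖y (ξ j)‖ ^ 2) ^ (p / 2) := by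
    rw [ha, hb, dNorm_pow ξ hp0, dNorm_pow ξ hp0, ← mul_add, ← Finset.sum_add_distrib,
      mul_div_assoc]
    apply mul_le_mul_of_nonneg_left _ (by positivity)
    rw [div_le_iff₀ (by norm_num), Finset.sum_mul]
    apply Finset.sum_le_sum
    intro j _
    have := scalar_ineq hp (x (ξ j)) (y (ξ j))
    simp only [Pi.add_apply, Pi.sub_apply]
    linarith
  have hmink := Real.Lp_add_le_of_nonneg (s := Finset.univ) (f := fun j => ‖x (ξ j)‖ ^ 2)
    (g := fun j => (p + 1) ^ 2 * ‖y (ξ j)‖ ^ 2) (p := p / 2) (by linarith)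
    (fun _ _ => by positivity) (fun _ _ => by positivity)
  have hm : 0 ≤ ((m : ℝ)⁻¹) ^ (1 / (p / 2)) := by positivity
  have hmink2 := mul_le_mul_of_nonneg_left hmink hm
  rw [mul_add, ← Real.mul_rpow (by positivity) (by positivity),
    ← Real.mul_rpow (by positivity) (by positivity),
    ← Real.mul_rpow (by positivity) (by positivity)] at hmink2
  have key : ∀ z : ℂ, ‖z‖ ^ p = (‖z‖ ^ 2) ^ (p / 2) := by
    intro z
    rw [← Real.rpow_natCast, ← Real.rpow_mul (norm_nonneg z)]
    congr 1; push_cast; ring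
  have keyn : ∀ f : X → ℂ, ((m : ℝ)⁻¹ * ∑ j, (‖f (ξ j)‖ ^ 2) ^ (p / 2)) ^ (1 / (p / 2)) = dNorm ξ p f ^ 2 := by
    intro f
    simp only [← key]
    rw [← dNorm_pow ξ hp0, ← Real.rpow_mul (dNorm_nonneg ξ f), ← Real.rpow_natCast]
    congr 1; push_cast; field_simp
  have keyy : ((m : ℝ)⁻¹ * ∑ j, ((p + 1) ^ 2 * ‖y (ξ j)‖ ^ 2) ^ (p / 2)) ^ (1 / (p / 2))
      = (p + 1) ^ 2 * T ^ 2 := by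
    have : ∀ j, ((p + 1) ^ 2 * ‖y (ξ j)‖ ^ 2) ^ (p / 2) = ((p+1)^2) ^ (p / 2) * (‖y (ξ j)‖ ^ 2) ^ (p / 2) := by
      intro j; rw [Real.mul_rpow (by positivity) (by positivity)]
    simp only [this]
    rw [← Finset.mul_sum, mul_left_comm, Real.mul_rpow (by positivity) (by positivity), keyn,
      ← Real.rpow_mul (by positivity), mul_one_div_cancel (by positivity), Real.rpow_one]
  rw [keyn, keyy] at hmink2
  -- (a+b)/2 squared ≤ S^2 + C T^2
  have h3 : ((a + b) / 2) ^ 2 ≤ S ^ 2 + (p + 1) ^ 2 * T ^ 2 := by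
    refine le_trans ?_ hmink2
    have h4 := Real.rpow_le_rpow (by positivity) (h1.trans h2) (by positivity : 0 ≤ 1 / (p / 2))
    refine le_trans (le_of_eq ?_) h4
    rw [← Real.rpow_mul (by positivity), ← Real.rpow_natCast]
    congr 1; push_cast; field_simp
  have h5 : (a + b) / 2 ≤ S + (p + 1) ^ 2 * T ^ 2 / (2 * S) := by
    apply abs_le_of_sq_le_sq' _ (by positivity) |>.2
    have : (S + (p + 1) ^ 2 * T ^ 2 / (2 * S)) ^ 2 =
      S ^ 2 + (p + 1) ^ 2 * T ^ 2 + ((p + 1) ^ 2 * T ^ 2 / (2 * S)) ^ 2 := by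
      field_simp; ring
    rw [this]
    nlinarith [sq_nonneg ((p + 1) ^ 2 * T ^ 2 / (2 * S))]
  have : (p + 1) ^ 2 * T ^ 2 / (2 * S) = ((p + 1) ^ 2 * T ^ 2 / S) / 2 := by field_simp
  linarith

end dn

section wc

variable {X ι : Type*} {g : ι → X → ℂ} {nrm : (X → ℂ) → ℝ} {t : ℝ} {f0 : X → ℂ} {φ : ℕ → ι}
  {G : ℕ → X → ℂ}

/-- span of the first `k` chosen elements -/
def spn (g : ι → X → ℂ) (φ : ℕ → ι) (k : ℕ) : Submodule ℂ (X → ℂ) :=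
  Submodule.span ℂ ((fun j => g (φ j)) '' Set.Iio k)

def Gam (φ : ℕ → ι) (k : ℕ) : Finset ι := (Finset.range k).image φ

lemma Gam_mono (φ : ℕ → ι) {k l : ℕ} (h : k ≤ l) : Gam φ k ⊆ Gam φ l :=
  Finset.image_subset_image (Finset.range_mono h)

lemma Gam_card (φ : ℕ → ι) (k : ℕ) : (Gam φ k).card ≤ k := by
  have := Finset.card_image_le (s := Finset.range k) (f := φ)
  simpa [Gam] using this

lemma spn_mono {k l : ℕ} (h : k ≤ l) : spn g φ k ≤ spn g φ l :=
  Submodule.span_mono (Set.image_mono (Set.Iio_subset_Iio h))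

lemma mem_spn_iff_sum {k : ℕ} {y : X → ℂ} (h : y ∈ spn g φ k) :
    ∃ c : ι → ℂ, (∀ i, i ∉ Gam φ k → c i = 0) ∧ y = ∑ i ∈ Gam φ k, c i • g i := by
  have e : (fun j => g (φ j)) '' Set.Iio k = g '' (Gam φ k : Set ι) := by
    ext z
    simp [Gam]
  rw [spn, e, Submodule.mem_span_image_finset_iff_exists_fun] at h
  obtain ⟨c, hc⟩ := h
  refine ⟨fun i => if hi : i ∈ Gam φ k then c ⟨i, hi⟩ else 0, ?_, ?_⟩
  · intro i hi; simp [hi]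
  · rw [← hc, ← Finset.sum_coe_sort (Gam φ k)]
    apply Finset.sum_congr rfl
    intro i _
    simp

lemma mem_spn_g {k : ℕ} {i : ι} (h : i ∈ Gam φ k) : g i ∈ spn g φ k := by
  simp only [Gam, Finset.mem_image, Finset.mem_range] at h
  obtain ⟨j, hj, rfl⟩ := h
  exact Submodule.subset_span ⟨j, hj, rfl⟩

lemma G_mem (hW : IsWCGA g nrm t f0 φ G) (k : ℕ) : G k ∈ spn g φ k := by
  cases k with
  | zero => rw [hW.1]; exact Submodule.zero_mem _
  | succ k =>
    have := (hW.2 k).2.1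
    have e : Set.Iic k = Set.Iio (k + 1) := by ext z; simp [Nat.lt_succ_iff]
    rw [e] at this
    exact this

lemma nrm_neg (hsm : ∀ (c : ℂ) f, nrm (c • f) = ‖c‖ * nrm f) (f : X → ℂ) : nrm (-f) = nrm f := by
  have := hsm (-1) f
  simpa using this

lemma nrm_sum_le (hadd : ∀ f h, nrm (f + h) ≤ nrm f + nrm h)
    (hsm : ∀ (c : ℂ) f, nrm (c • f) = ‖c‖ * nrm f) (hg : ∀ i, nrm (g i) ≤ 1)
    (A : Finset ι) (c : ι → ℂ) : nrm (∑ i ∈ A, c i • g i) ≤ ∑ i ∈ A, ‖c i‖ := by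
  induction A using Finset.induction_on with
  | empty =>
    have := hsm 0 0
    simp at this
    simp [this]
  | insert a s ha ih =>
    rw [Finset.sum_insert ha, Finset.sum_insert ha]
    refine (hadd _ _).trans (add_le_add ?_ ih)
    rw [hsm]
    exact mul_le_of_le_one_right (norm_nonneg _) (hg a)

/-- best approximation -/
lemma G_best (hadd : ∀ f h, nrm (f + h) ≤ nrm f + nrm h)
    (hW : IsWCGA g nrm t f0 φ G) (k : ℕ) (h : X → ℂ) (hh : h ∈ spn g φ k) :
    nrm (f0 - G k) ≤ nrm (f0 - h) := by
  cases k with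
  | zero =>
    have : h = 0 := by simpa [spn] using hh
    rw [this, hW.1]
  | succ k =>
    have e : Set.Iio (k + 1) = Set.Iic k := by ext z; simp [Nat.lt_succ_iff]
    rw [spn, e] at hh
    exact (hW.2 k).2.2 h hh

lemma r_mono (hadd : ∀ f h, nrm (f + h) ≤ nrm f + nrm h)
    (hW : IsWCGA g nrm t f0 φ G) {k l : ℕ} (h : k ≤ l) :
    nrm (f0 - G l) ≤ nrm (f0 - G k) :=
  G_best hadd hW l (G k) (spn_mono h (G_mem hW k))

/-- basic smoothness consequence -/
lemma smooth_F {γ : ℝ} (hsmooth : ∀ x y, 0 < nrm x → nrm (x + y) + nrm (x - y) ≤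
      2 * nrm x + γ * nrm y ^ 2 / nrm x)
    (F : (X → ℂ) →ₗ[ℂ] ℂ) (hF : ∀ h, ‖F h‖ ≤ nrm h) (x : X → ℂ) (hx : 0 < nrm x)
    (hFx : F x = ((nrm x : ℝ) : ℂ)) (y : X → ℂ) :
    nrm (x - y) ≤ nrm x - (F y).re + γ * nrm y ^ 2 / nrm x := by
  have h1 := hsmooth x y hx
  have h2 : nrm x + (F y).re ≤ nrm (x + y) := by
    calc nrm x + (F y).re = (F (x + y)).re := by rw [map_add, hFx]; simp
      _ ≤ ‖F (x + y)‖ := Complex.re_le_norm _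
      _ ≤ _ := hF _
  linarith

lemma exists_phase (z : ℂ) : ∃ w : ℂ, ‖w‖ = 1 ∧ w * z = (‖z‖ : ℂ) := by
  by_cases hz : z = 0
  · exact ⟨1, by simp, by simp [hz]⟩
  · refine ⟨(starRingEnd ℂ) z / ‖z‖, ?_, ?_⟩
    · simp [hz]
    · have : (‖z‖ : ℂ) ≠ 0 := by simpa using hz
      rw [div_mul_eq_mul_div, mul_comm, Complex.mul_conj, Complex.normSq_eq_norm_sq]
      field_simp
      push_cast; ring

lemma F_vanish {γ : ℝ} (hγ : 0 ≤ γ) (hadd : ∀ f h, nrm (f + h) ≤ nrm f + nrm h)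
    (hsm : ∀ (c : ℂ) f, nrm (c • f) = ‖c‖ * nrm f)
    (hsmooth : ∀ x y, 0 < nrm x → nrm (x + y) + nrm (x - y) ≤
      2 * nrm x + γ * nrm y ^ 2 / nrm x)
    (hW : IsWCGA g nrm t f0 φ G) (k : ℕ)
    (F : (X → ℂ) →ₗ[ℂ] ℂ) (hF : ∀ h, ‖F h‖ ≤ nrm h) (hx : 0 < nrm (f0 - G k))
    (hFx : F (f0 - G k) = ((nrm (f0 - G k) : ℝ) : ℂ)) (y : X → ℂ) (hy : y ∈ spn g φ k) :
    F y = 0 := by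
  obtain ⟨w, hw1, hw2⟩ := exists_phase (F y)
  set r := nrm (f0 - G k) with hr
  set Q := γ * nrm y ^ 2 / r with hQ
  have hQ0 : 0 ≤ Q := by positivity
  have key : ∀ l : ℝ, 0 < l → ‖F y‖ ≤ l * Q := by
    intro l hl
    have hmem : ((l : ℂ) * w) • y ∈ spn g φ k := Submodule.smul_mem _ _ hy
    have h1 := smooth_F hsmooth F hF _ hx hFx (((l : ℂ) * w) • y)
    have h2 : r ≤ nrm (f0 - G k - ((l : ℂ) * w) • y) := by
      rw [sub_sub]
      exact G_best hadd hW k _ (Submodule.add_mem _ (G_mem hW k) hmem)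
    have h3 : (F (((l : ℂ) * w) • y)).re = l * ‖F y‖ := by
      rw [map_smul, smul_eq_mul, mul_assoc, hw2, ← Complex.ofReal_mul, Complex.ofReal_re]
    have h4 : nrm (((l : ℂ) * w) • y) = l * nrm y := by
      rw [hsm, norm_mul, hw1]; simp [abs_of_pos hl]
    rw [h3, h4] at h1
    have h5 : γ * (l * nrm y) ^ 2 / r = l * (l * Q) := by rw [hQ]; ring
    rw [h5] at h1
    have : l * ‖F y‖ ≤ l * (l * Q) := by linarith
    exact le_of_mul_le_mul_left this hl
  have : ‖F y‖ ≤ 0 := by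
    by_contra hcon
    push Not at hcon
    have := key (‖F y‖ / (2 * (Q + 1))) (by positivity)
    have h2 : ‖F y‖ / (2 * (Q + 1)) * Q ≤ ‖F y‖ / 2 := by
      rw [div_mul_eq_mul_div, div_le_div_iff₀ (by positivity) (by norm_num)]
      nlinarith
    linarith
  simpa using this

variable {γ V : ℝ} {T : Finset ι} {a : ι → ℂ} {u : ℕ}

lemma inc_bound (hadd : ∀ f h, nrm (f + h) ≤ nrm f + nrm h)
    (hsm : ∀ (c : ℂ) f, nrm (c • f) = ‖c‖ * nrm f) (hV : 0 ≤ V)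
    (hinc : ∀ (A B : Finset ι), A ⊆ B → B.card ≤ T.card + u → ∀ c : ι → ℂ,
      ∑ i ∈ A, ‖c i‖ ≤ V * Real.sqrt A.card * nrm (∑ i ∈ B, c i • g i))
    (hW : IsWCGA g nrm t f0 φ G) (k : ℕ) (hk : k ≤ u) (A : Finset ι) (hA : A ⊆ T \ Gam φ k) :
    ∑ i ∈ A, ‖a i‖ ≤ V * Real.sqrt A.card *
      (nrm (f0 - G k) + nrm (f0 - ∑ i ∈ T, a i • g i)) := by
  obtain ⟨c, hc0, hc⟩ := mem_spn_iff_sum (G_mem hW k)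
  have h1 := hinc A (T ∪ Gam φ k)
    (hA.trans (Finset.sdiff_subset.trans Finset.subset_union_left))
    ((Finset.card_union_le _ _).trans (by have := Gam_card φ k; omega))
    (fun i => (if i ∈ T then a i else 0) - c i)
  have h2 : ∑ i ∈ A, ‖a i‖ = ∑ i ∈ A, ‖(if i ∈ T then a i else 0) - c i‖ := by
    apply Finset.sum_congr rfl
    intro i hi
    have := Finset.mem_sdiff.mp (hA hi)
    simp [this.1, hc0 i this.2]
  have h3 : ∑ i ∈ T ∪ Gam φ k, ((if i ∈ T then a i else 0) - c i) • g i =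
      (∑ i ∈ T, a i • g i) - G k := by
    simp only [sub_smul, Finset.sum_sub_distrib]
    congr 1
    · rw [← Finset.sum_subset (Finset.subset_union_left (s₁ := T) (s₂ := Gam φ k))]
      · apply Finset.sum_congr rfl
        intro i hi; simp [hi]
      · intro i _ hi; simp [hi]
    · rw [hc, ← Finset.sum_subset (Finset.subset_union_right (s₁ := T) (s₂ := Gam φ k))]
      intro i _ hi; simp [hc0 i hi]
  rw [h2]
  refine h1.trans ?_
  apply mul_le_mul_of_nonneg_left _ (by positivity)
  rw [h3]
  have : (∑ i ∈ T, a i • g i) - G k = (f0 - G k) + -(f0 - ∑ i ∈ T, a i • g i) := by abel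
  rw [this]
  refine (hadd _ _).trans ?_
  rw [nrm_neg hsm]

lemma r_le (hadd : ∀ f h, nrm (f + h) ≤ nrm f + nrm h)
    (hsm : ∀ (c : ℂ) f, nrm (c • f) = ‖c‖ * nrm f) (hg : ∀ i, nrm (g i) ≤ 1)
    (hW : IsWCGA g nrm t f0 φ G) (k : ℕ) :
    nrm (f0 - G k) ≤ nrm (f0 - ∑ i ∈ T, a i • g i) + ∑ i ∈ T \ Gam φ k, ‖a i‖ := by
  have h1 := G_best hadd hW k (∑ i ∈ T ∩ Gam φ k, a i • g i)
    (Submodule.sum_mem _ fun i hi => Submodule.smul_mem _ _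
      (mem_spn_g (Finset.mem_inter.mp hi).2))
  refine h1.trans ?_
  have : f0 - ∑ i ∈ T ∩ Gam φ k, a i • g i =
      (f0 - ∑ i ∈ T, a i • g i) + ∑ i ∈ T \ Gam φ k, a i • g i := by
    rw [← Finset.sum_inter_add_sum_sdiff T (Gam φ k)]
    abel
  rw [this]
  exact (hadd _ _).trans (add_le_add le_rfl (nrm_sum_le hadd hsm hg _ _))

lemma step (hγ : 0 < γ) (ht : 0 < t) (hV : 0 < V)
    (hadd : ∀ f h, nrm (f + h) ≤ nrm f + nrm h)
    (hnn : ∀ f, 0 ≤ nrm f)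
    (hsm : ∀ (c : ℂ) f, nrm (c • f) = ‖c‖ * nrm f) (hg : ∀ i, nrm (g i) ≤ 1)
    (hsmooth : ∀ x y, 0 < nrm x → nrm (x + y) + nrm (x - y) ≤
      2 * nrm x + γ * nrm y ^ 2 / nrm x)
    (hinc : ∀ (A B : Finset ι), A ⊆ B → B.card ≤ T.card + u → ∀ c : ι → ℂ,
      ∑ i ∈ A, ‖c i‖ ≤ V * Real.sqrt A.card * nrm (∑ i ∈ B, c i • g i))
    (hW : IsWCGA g nrm t f0 φ G) (k : ℕ) (hk : k ≤ u) (B : Finset ι) (j : ℕ) (hj : 0 < j)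
    (hB : ((T \ Gam φ k) \ B).card ≤ j) (s : ℝ) (hs : ∑ i ∈ B, ‖a i‖ ≤ s)
    (hr : 2 * (s + nrm (f0 - ∑ i ∈ T, a i • g i)) < nrm (f0 - G k)) :
    nrm (f0 - G (k + 1)) ≤ nrm (f0 - G k) * (1 - t ^ 2 / (36 * γ * V ^ 2 * j)) := by
  obtain ⟨⟨F, hF1, hF2, hF3⟩, -⟩ := hW.2 k
  set r := nrm (f0 - G k) with hrdef
  set ε := nrm (f0 - ∑ i ∈ T, a i • g i) with hε
  have hε0 : 0 ≤ ε := hnn _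
  have hs0 : 0 ≤ s := le_trans (Finset.sum_nonneg fun _ _ => norm_nonneg _) hs
  have hr0 : 0 < r := by nlinarith
  have hvan := F_vanish hγ.le hadd hsm hsmooth hW k F hF1 hr0 hF2
  set b := ‖F (g (φ k))‖ with hb
  set A := (T \ Gam φ k) \ B with hA
  -- F(f_k) = F(f0 - h) + F(sum over T \ Gam)
  have e1 : F (f0 - G k) = F (f0 - ∑ i ∈ T, a i • g i) + ∑ i ∈ T \ Gam φ k, a i * F (g i) := by
    have : f0 - G k = (f0 - ∑ i ∈ T, a i • g i) + (∑ i ∈ T \ Gam φ k, a i • g i +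
        ((∑ i ∈ T ∩ Gam φ k, a i • g i) - G k)) := by
      rw [← Finset.sum_inter_add_sum_sdiff T (Gam φ k)]
      abel
    rw [this, map_add, map_add]
    rw [hvan (_ - G k) (Submodule.sub_mem _ (Submodule.sum_mem _ fun i hi =>
      Submodule.smul_mem _ _ (mem_spn_g (Finset.mem_inter.mp hi).2)) (G_mem hW k)), add_zero]
    simp [map_sum]
  have hFg : ∀ i, ‖F (g i)‖ ≤ b / t := by
    intro i
    rw [le_div_iff₀ ht, mul_comm]
    exact hF3 i
  have hFg1 : ∀ i, ‖F (g i)‖ ≤ 1 := fun i => (hF1 _).trans (hg i)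
  have e2 : r ≤ ε + ((b / t) * ∑ i ∈ A, ‖a i‖ + s) := by
    have h1 : r = ‖F (f0 - G k)‖ := by rw [hF2]; simp [abs_of_pos hr0]
    rw [h1, e1]
    refine (norm_add_le _ _).trans (add_le_add (hF1 _) ?_)
    refine (norm_sum_le _ _).trans ?_
    rw [← Finset.sum_inter_add_sum_sdiff (T \ Gam φ k) B, add_comm]
    apply add_le_add
    · rw [Finset.mul_sum]
      apply Finset.sum_le_sum
      intro i _
      rw [norm_mul, mul_comm]
      exact mul_le_mul_of_nonneg_right (hFg i) (norm_nonneg _)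
    · refine le_trans ?_ hs
      refine le_trans (Finset.sum_le_sum (g := fun i => ‖a i‖) ?_) ?_
      · intro i _
        rw [norm_mul]
        exact mul_le_of_le_one_right (norm_nonneg _) (hFg1 i)
      · exact Finset.sum_le_sum_of_subset_of_nonneg Finset.inter_subset_right
          (fun _ _ _ => norm_nonneg _)
  have e3 := inc_bound (a := a) hadd hsm hV.le hinc hW k hk A Finset.sdiff_subset
  rw [← hrdef, ← hε] at e3
  have hsq : Real.sqrt A.card ≤ Real.sqrt j := Real.sqrt_le_sqrt (by exact_mod_cast hB)
  have hj' : (0 : ℝ) < j := by exact_mod_cast hj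
  have hsj : 0 < Real.sqrt j := Real.sqrt_pos.mpr hj'
  have hb0 : 0 ≤ b := norm_nonneg _
  have e4 : ∑ i ∈ A, ‖a i‖ ≤ V * Real.sqrt j * (3 / 2 * r) := by
    refine e3.trans ?_
    apply mul_le_mul _ (by linarith) (by positivity) (by positivity)
    exact mul_le_mul_of_nonneg_left hsq hV.le
  have e5 : r / 2 ≤ (b / t) * (V * Real.sqrt j * (3 / 2 * r)) := by
    have : (b / t) * ∑ i ∈ A, ‖a i‖ ≤ (b / t) * (V * Real.sqrt j * (3 / 2 * r)) :=
      mul_le_mul_of_nonneg_left e4 (by positivity)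
    linarith
  have e6 : t ≤ 3 * b * V * Real.sqrt j := by
    have : (b / t) * (V * Real.sqrt j * (3 / 2 * r)) = (3 * b * V * Real.sqrt j / t) * (r / 2) := by
      field_simp
    rw [this] at e5
    have : 1 ≤ 3 * b * V * Real.sqrt j / t := by
      by_contra hcon
      push Not at hcon
      nlinarith
    rwa [le_div_iff₀ ht, one_mul] at this
  have e7 : t ^ 2 / (36 * γ * V ^ 2 * j) ≤ b ^ 2 / (4 * γ) := by
    rw [div_le_div_iff₀ (by positivity) (by positivity)]
    have h1 : t ^ 2 ≤ 9 * b ^ 2 * V ^ 2 * j := by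
      calc t ^ 2 ≤ (3 * b * V * Real.sqrt j) ^ 2 := pow_le_pow_left₀ ht.le e6 2
        _ = 9 * b ^ 2 * V ^ 2 * (Real.sqrt j) ^ 2 := by ring
        _ = _ := by rw [Real.sq_sqrt hj'.le]
    calc t ^ 2 * (4 * γ) ≤ (9 * b ^ 2 * V ^ 2 * j) * (4 * γ) := by gcongr
      _ = _ := by ring
  -- decay
  obtain ⟨w, hw1, hw2⟩ := exists_phase (F (g (φ k)))
  set l : ℝ := b / (2 * γ) * r with hl
  have hl0 : 0 ≤ l := by positivity
  have h1 := smooth_F hsmooth F hF1 _ hr0 hF2 (((l : ℂ) * w) • g (φ k))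
  have h3 : (F (((l : ℂ) * w) • g (φ k))).re = l * b := by
    rw [map_smul, smul_eq_mul, mul_assoc, hw2, ← Complex.ofReal_mul, Complex.ofReal_re]
  have h4 : nrm (((l : ℂ) * w) • g (φ k)) ≤ l := by
    rw [hsm, norm_mul, hw1]
    simp only [Complex.norm_real, Real.norm_eq_abs, abs_of_nonneg hl0, mul_one]
    exact mul_le_of_le_one_right hl0 (hg _)
  have h5 : nrm (f0 - G (k + 1)) ≤ nrm (f0 - G k - ((l : ℂ) * w) • g (φ k)) := by
    rw [sub_sub]
    apply G_best hadd hW (k + 1)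
    apply Submodule.add_mem _ (spn_mono (Nat.le_succ k) (G_mem hW k))
    apply Submodule.smul_mem _ _ (mem_spn_g _)
    exact Finset.mem_image_of_mem _ (Finset.self_mem_range_succ k)
  have h6 : γ * nrm (((l : ℂ) * w) • g (φ k)) ^ 2 / r ≤ γ * l ^ 2 / r := by
    gcongr
    exact hnn _
  rw [h3] at h1
  have h7 : r - l * b + γ * l ^ 2 / r = r * (1 - b ^ 2 / (4 * γ)) := by
    rw [hl]; field_simp; ring
  calc nrm (f0 - G (k + 1)) ≤ r - l * b + γ * l ^ 2 / r := by linarith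
    _ = _ := h7
    _ ≤ _ := by apply mul_le_mul_of_nonneg_left _ hr0.le; linarith

/-- phase lemma -/
lemma phase (hγ : 0 < γ) (ht : 0 < t) (hV : 0 < V)
    (hadd : ∀ f h, nrm (f + h) ≤ nrm f + nrm h)
    (hnn : ∀ f, 0 ≤ nrm f)
    (hsm : ∀ (c : ℂ) f, nrm (c • f) = ‖c‖ * nrm f) (hg : ∀ i, nrm (g i) ≤ 1)
    (hsmooth : ∀ x y, 0 < nrm x → nrm (x + y) + nrm (x - y) ≤
      2 * nrm x + γ * nrm y ^ 2 / nrm x)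
    (hinc : ∀ (A B : Finset ι), A ⊆ B → B.card ≤ T.card + u → ∀ c : ι → ℂ,
      ∑ i ∈ A, ‖c i‖ ≤ V * Real.sqrt A.card * nrm (∑ i ∈ B, c i • g i))
    (hW : IsWCGA g nrm t f0 φ G) (k : ℕ) (B : Finset ι) (j : ℕ) (hj : 0 < j)
    (hB : ((T \ Gam φ k) \ B).card ≤ j) (s : ℝ) (hs : ∑ i ∈ B, ‖a i‖ ≤ s) (n : ℕ)
    (hn : k + n ≤ u) :
    nrm (f0 - G (k + n)) ≤ 2 * (s + nrm (f0 - ∑ i ∈ T, a i • g i)) ∨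
    nrm (f0 - G (k + n)) ≤ nrm (f0 - G k) * Real.exp (-(t ^ 2 / (36 * γ * V ^ 2 * j)) * n) := by
  induction n with
  | zero => right; simp
  | succ n ih =>
    rcases ih (by omega) with h | h
    · left
      exact (r_mono hadd hW (by omega)).trans h
    · by_cases hc : nrm (f0 - G (k + n)) ≤ 2 * (s + nrm (f0 - ∑ i ∈ T, a i • g i))
      · left
        exact (r_mono hadd hW (by omega)).trans hc
      · right
        push Not at hc
        have hB' : ((T \ Gam φ (k + n)) \ B).card ≤ j := by
          refine le_trans (Finset.card_le_card ?_) hB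
          apply Finset.sdiff_subset_sdiff _ le_rfl
          exact Finset.sdiff_subset_sdiff le_rfl (Gam_mono φ (by omega))
        have := step hγ ht hV hadd hnn hsm hg hsmooth hinc hW (k + n) (by omega) B j hj hB' s hs hc
        rw [← add_assoc]
        refine this.trans ?_
        set x := t ^ 2 / (36 * γ * V ^ 2 * j)
        have h1 : 1 - x ≤ Real.exp (-x) := by
          have := Real.add_one_le_exp (-x); linarith
        calc nrm (f0 - G (k + n)) * (1 - x) ≤ nrm (f0 - G (k + n)) * Real.exp (-x) :=
              mul_le_mul_of_nonneg_left h1 (hnn _)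
          _ ≤ (nrm (f0 - G k) * Real.exp (-x * n)) * Real.exp (-x) :=
              mul_le_mul_of_nonneg_right h (Real.exp_pos _).le
          _ = _ := by rw [mul_assoc, ← Real.exp_add]; congr 2; push_cast; ring

lemma exists_tail (A : Finset ι) (M : ι → ℝ) (j : ℕ) (hM : ∀ i, 0 ≤ M i) :
    ∃ B ⊆ A, (A \ B).card ≤ j ∧ (A.card ≤ j → ∑ i ∈ B, M i = 0) ∧
      ∀ B' ⊆ A, A.card - j ≤ B'.card → ∑ i ∈ B, M i ≤ ∑ i ∈ B', M i := by
  have hne : (Finset.powersetCard (A.card - j) A).Nonempty :=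
    Finset.powersetCard_nonempty.mpr (Nat.sub_le _ _)
  obtain ⟨B, hB, hmin⟩ := Finset.exists_min_image _ (fun B => ∑ i ∈ B, M i) hne
  rw [Finset.mem_powersetCard] at hB
  refine ⟨B, hB.1, ?_, ?_, ?_⟩
  · rw [Finset.card_sdiff_of_subset hB.1]; omega
  · intro h
    have : B = ∅ := by rw [← Finset.card_eq_zero]; omega
    simp [this]
  · intro B' hB' hc
    obtain ⟨B'', h1, h2⟩ := Finset.exists_subset_card_eq hc
    refine (hmin B'' (Finset.mem_powersetCard.mpr ⟨h1.trans hB', h2⟩)).trans ?_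
    exact Finset.sum_le_sum_of_subset_of_nonneg h1 (fun i _ _ => hM i)

theorem wcga_main (hγ : 0 < γ) (ht : 0 < t) (hV : 1 ≤ V)
    (hadd : ∀ f h, nrm (f + h) ≤ nrm f + nrm h)
    (hnn : ∀ f, 0 ≤ nrm f)
    (hsm : ∀ (c : ℂ) f, nrm (c • f) = ‖c‖ * nrm f) (hg : ∀ i, nrm (g i) ≤ 1)
    (hsmooth : ∀ x y, 0 < nrm x → nrm (x + y) + nrm (x - y) ≤
      2 * nrm x + γ * nrm y ^ 2 / nrm x)
    (hinc : ∀ (A B : Finset ι), A ⊆ B → B.card ≤ T.card + u → ∀ c : ι → ℂ,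
      ∑ i ∈ A, ‖c i‖ ≤ V * Real.sqrt A.card * nrm (∑ i ∈ B, c i • g i))
    (hW : IsWCGA g nrm t f0 φ G) (v : ℕ) (hv : 0 < v) (hTv : T.card ≤ v) (K : ℕ)
    (hK : Real.exp (-(t ^ 2 / (36 * γ * V ^ 2)) * K / 2) * (5 * V * Real.sqrt v) ≤ 1)
    (hKu : 2 * K * v ≤ u) :
    nrm (f0 - G u) ≤ 2 * nrm (f0 - ∑ i ∈ T, a i • g i) := by
  have hV0 : 0 < V := by linarith
  set ε := nrm (f0 - ∑ i ∈ T, a i • g i) with hε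
  have hε0 : 0 ≤ ε := hnn _
  set q := t ^ 2 / (36 * γ * V ^ 2) with hq
  have hq0 : 0 < q := by positivity
  set η := Real.exp (-q * K / 2) with hη
  have hη0 : 0 < η := Real.exp_pos _
  have hsv1 : 1 ≤ Real.sqrt v := by
    rw [Real.one_le_sqrt]; exact_mod_cast hv
  have hη5 : η ≤ 1 / 5 := by
    have : 5 ≤ 5 * V * Real.sqrt v := by nlinarith
    nlinarith
  have main : ∀ n k : ℕ, (T \ Gam φ k).card = n → k + 2 * K * n ≤ u →
      nrm (f0 - G (k + 2 * K * n)) ≤ 2 * ε := by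
    intro n
    induction n using Nat.strong_induction_on with
    | _ n IH =>
    intro k hn hku
    rcases Nat.eq_zero_or_pos n with h0 | hpos
    · subst h0
      have h1 := r_le (T := T) (a := a) hadd hsm hg hW k
      rw [Finset.card_eq_zero.mp hn] at h1
      simp only [Finset.sum_empty, add_zero] at h1
      simp only [mul_zero, add_zero]
      linarith
    set A := T \ Gam φ k with hA
    choose B hBA hBc hB0 hBmin using fun j => exists_tail A (fun i => ‖a i‖) j (fun _ => norm_nonneg _)
    set s : ℕ → ℝ := fun j => ∑ i ∈ B j, ‖a i‖ with hs
    have hs0 : ∀ j, 0 ≤ s j := fun j => Finset.sum_nonneg fun _ _ => norm_nonneg _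
    have lev : ∀ l : ℕ, 2 ^ l ≤ 2 * n →
        nrm (f0 - G (k + 2 * K * n)) ≤ 2 * ε ∨
        nrm (f0 - G (k + K * 2 ^ l)) ≤ 2 * (s (2 ^ l - 1) + ε) := by
      intro l
      induction l with
      | zero =>
        intro _
        right
        have h1 := r_le (T := T) (a := a) hadd hsm hg hW k
        have h2 : ∑ i ∈ A, ‖a i‖ = s 0 := by
          have : B 0 = A := by
            have h3 := hBc 0
            apply Finset.Subset.antisymm (hBA 0)
            rw [← Finset.sdiff_eq_empty_iff_subset, ← Finset.card_eq_zero]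
            omega
          simp only [hs, this]
        have h3 := r_mono hadd hW (show k ≤ k + K * 2 ^ 0 by omega)
        simp only [pow_zero] at h3 ⊢
        have := hs0 0
        rw [← hA, h2] at h1
        simp only [Nat.sub_self]
        linarith
      | succ l ih =>
        intro hl
        have hl2 : 2 ^ l ≤ n := by rw [pow_succ] at hl; omega
        rcases ih (by omega) with h | h
        · exact Or.inl h
        have hpl : 1 ≤ 2 ^ l := Nat.one_le_two_pow
        have htime : k + K * 2 ^ l + K * 2 ^ l = k + K * 2 ^ (l + 1) := by rw [pow_succ]; ring
        have hle : K * 2 ^ (l + 1) ≤ 2 * K * n := by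
          calc K * 2 ^ (l + 1) ≤ K * (2 * n) := Nat.mul_le_mul_left _ hl
            _ = _ := by ring
        set j := 2 ^ (l + 1) - 1 with hj
        have hj0 : 0 < j := by rw [hj, pow_succ]; omega
        have hBc' : ((T \ Gam φ (k + K * 2 ^ l)) \ B j).card ≤ j := by
          refine le_trans (Finset.card_le_card ?_) (hBc j)
          apply Finset.sdiff_subset_sdiff _ le_rfl
          exact Finset.sdiff_subset_sdiff le_rfl (Gam_mono φ (by omega))
        have hph := phase (a := a) hγ ht hV0 hadd hnn hsm hg hsmooth hinc hW (k + K * 2 ^ l) (B j) j hj0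
          hBc' (s j) le_rfl (K * 2 ^ l) (by omega)
        rw [htime, ← hε] at hph
        by_cases hcase : nrm (f0 - G (k + K * 2 ^ (l + 1))) ≤ 2 * (s j + ε)
        · exact Or.inr hcase
        left
        have hph := hph.resolve_left hcase
        push Not at hcase
        set r := nrm (f0 - G (k + K * 2 ^ (l + 1))) with hr
        have hexp : Real.exp (-(t ^ 2 / (36 * γ * V ^ 2 * j)) * ((K * 2 ^ l : ℕ) : ℝ)) ≤ η := by
          rw [hη, Real.exp_le_exp]
          have hjr : (0 : ℝ) < j := by exact_mod_cast hj0
          have e : t ^ 2 / (36 * γ * V ^ 2 * j) = q / j := by rw [hq]; field_simp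
          have hj2 : (j : ℝ) ≤ 2 * 2 ^ l := by
            have : j ≤ 2 * 2 ^ l := by rw [hj, pow_succ]; omega
            exact_mod_cast this
          rw [e]
          push_cast
          have : q * K / 2 ≤ q / j * (K * 2 ^ l) := by
            rw [show q / j * (K * 2 ^ l) = q * (K * 2 ^ l) / j by ring,
              div_le_div_iff₀ (by norm_num) hjr]
            have : (0 : ℝ) ≤ q * K := by positivity
            nlinarith
          linarith
        have h2 : r ≤ 2 * (s (2 ^ l - 1) + ε) * η :=
          hph.trans (mul_le_mul h hexp (Real.exp_pos _).le (by have := hs0 (2 ^ l - 1); positivity))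
        set S := s (2 ^ l - 1) with hS
        have hSj := hs0 j
        have hS0 : 0 ≤ S := hs0 _
        have h3 : r ≤ 8 / 3 * η * S := by
          have : 2 * ε * η ≤ r * (1 / 4) := by nlinarith
          nlinarith
        have hr0 : 0 < r := by linarith
        have hSpos : 0 < S := by
          rcases hS0.lt_or_eq with h | h
          · exact h
          · rw [← h] at h3; linarith
        set k' := k + K * 2 ^ (l + 1) with hk'
        have hk'u : k' ≤ u := by omega
        have hsub : T \ Gam φ k' ⊆ A :=
          Finset.sdiff_subset_sdiff le_rfl (Gam_mono φ (by omega))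
        have hinc' := inc_bound (a := a) hadd hsm hV0.le hinc hW k' hk'u (T \ Gam φ k') le_rfl
        rw [← hr, ← hε] at hinc'
        have hcs : Real.sqrt (T \ Gam φ k').card ≤ Real.sqrt v := by
          apply Real.sqrt_le_sqrt
          exact_mod_cast (Finset.card_le_card Finset.sdiff_subset).trans hTv
        have h4 : ∑ i ∈ T \ Gam φ k', ‖a i‖ < S := by
          calc _ ≤ V * Real.sqrt (T \ Gam φ k').card * (r + ε) := hinc'
            _ ≤ V * Real.sqrt v * (3 / 2 * r) := by
              apply mul_le_mul _ (by linarith) (by positivity) (by positivity)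
              exact mul_le_mul_of_nonneg_left hcs hV0.le
            _ ≤ V * Real.sqrt v * (3 / 2 * (8 / 3 * η * S)) := by gcongr
            _ = (η * (5 * V * Real.sqrt v)) * (4 / 5 * S) := by ring
            _ ≤ 1 * (4 / 5 * S) := by
              apply mul_le_mul_of_nonneg_right hK; positivity
            _ < S := by linarith
        have h5 : (T \ Gam φ k').card + 2 ^ l ≤ n := by
          by_contra hcon
          have := hBmin (2 ^ l - 1) (T \ Gam φ k') hsub (by rw [hn]; omega)
          have : S ≤ ∑ i ∈ T \ Gam φ k', ‖a i‖ := this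
          linarith
        set n' := (T \ Gam φ k').card with hn'
        have h7 : k' + 2 * K * n' ≤ k + 2 * K * n := by
          rw [hk']
          have : K * 2 ^ (l + 1) + 2 * K * n' = 2 * K * (n' + 2 ^ l) := by rw [pow_succ]; ring
          have := Nat.mul_le_mul_left (2 * K) h5
          omega
        have h6 := IH n' (by omega) k' rfl (by omega)
        exact (r_mono hadd hW h7).trans h6
    have hlog1 : n < 2 ^ (Nat.log 2 n + 1) := Nat.lt_pow_succ_log_self (by norm_num) n
    have hlog2 : 2 ^ (Nat.log 2 n) ≤ n := Nat.pow_log_le_self 2 hpos.ne'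
    rcases lev (Nat.log 2 n + 1) (by rw [pow_succ]; omega) with h | h
    · exact h
    · have hz : s (2 ^ (Nat.log 2 n + 1) - 1) = 0 := hB0 _ (by rw [hn]; omega)
      rw [hz, zero_add] at h
      refine (r_mono hadd hW ?_).trans h
      calc k + K * 2 ^ (Nat.log 2 n + 1) ≤ k + K * (2 * n) := by
            gcongr; rw [pow_succ]; omega
        _ = _ := by ring
  have hcard : (T \ Gam φ 0).card ≤ v := (Finset.card_le_card Finset.sdiff_subset).trans hTv
  have hle : 0 + 2 * K * (T \ Gam φ 0).card ≤ u := by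
    rw [zero_add]
    exact (Nat.mul_le_mul_left _ hcard).trans hKu
  exact (r_mono hadd hW hle).trans (main _ 0 rfl hle)

end wc

lemma exp_ind_int {X : Type*} [MeasurableSpace X] (μ : Measure X) [IsProbabilityMeasure μ]
    (E : Set X) (hE : MeasurableSet E) :
    Integrable (fun x => Real.exp (-(E.indicator (fun _ => (1:ℝ)) x))) μ ∧
    ∫ x, Real.exp (-(E.indicator (fun _ => (1:ℝ)) x)) ∂μ ≤ Real.exp (-(μ.real E / 4)) := by
  have h0 : (fun x => Real.exp (-(E.indicator (fun _ => (1:ℝ)) x))) =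
      fun x => 1 - (1 - Real.exp (-1)) * E.indicator (fun _ => (1:ℝ)) x := by
    funext x
    by_cases hx : x ∈ E <;> simp [hx]
  have hi : Integrable (E.indicator (fun _ => (1:ℝ))) μ :=
    (integrable_const (1:ℝ)).indicator hE
  rw [h0]
  refine ⟨(integrable_const _).sub (hi.const_mul _), ?_⟩
  rw [integral_sub (integrable_const _) (hi.const_mul _), integral_const_mul,
    integral_indicator hE]
  simp only [integral_const, probReal_univ, smul_eq_mul, mul_one, measureReal_restrict_apply_univ]
  have h1 := Real.add_one_le_exp (-(μ.real E / 4))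
  have h2 : Real.exp (-1) ≤ 1/2 := by
    rw [Real.exp_neg]
    have := Real.add_one_le_exp (1:ℝ)
    rw [inv_le_comm₀ (Real.exp_pos _) (by norm_num)]
    linarith
  have h3 : 0 ≤ μ.real E := measureReal_nonneg
  nlinarith

lemma random_pts {X : Type*} [MeasurableSpace X] (μ : Measure X) [IsProbabilityMeasure μ]
    {I : Type*} [Fintype I] (E : I → Set X) (hE : ∀ i, MeasurableSet (E i)) (L : I → ℝ)
    (hL : ∑ i, Real.exp (-L i) < 1) (m : ℕ) (hm : 0 < m) :
    ∃ ξ : Fin m → X, ∀ i, μ.real (E i) ≤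
      4 * ((m:ℝ)⁻¹ * ∑ j, (E i).indicator (fun _ => (1:ℝ)) (ξ j)) + 4 * L i / m := by
  set ν : Measure (Fin m → X) := Measure.pi (fun _ => μ) with hν
  let T : I → (Fin m → X) → ℝ := fun i ξ => (Real.exp (-L i) * Real.exp (μ.real (E i) * m / 4)) *
    ∏ j, Real.exp (-((E i).indicator (fun _ => (1:ℝ)) (ξ j)))
  have hint : ∀ i, Integrable (T i) ν := by
    intro i
    apply Integrable.const_mul
    exact Integrable.fintype_prod (f := fun _ x => Real.exp (-((E i).indicator (fun _ => (1:ℝ)) x)))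
      (fun _ => (exp_ind_int μ (E i) (hE i)).1)
  have hle : ∀ i, ∫ ξ, T i ξ ∂ν ≤ Real.exp (-L i) := by
    intro i
    simp only [T]
    rw [integral_const_mul, hν, integral_fintype_prod_eq_pow (ι := Fin m)
      (f := fun x => Real.exp (-((E i).indicator (fun _ => (1:ℝ)) x)))]
    have h1 := pow_le_pow_left₀ (integral_nonneg (fun x => (Real.exp_pos _).le))
      (exp_ind_int μ (E i) (hE i)).2 (Fintype.card (Fin m))
    rw [Fintype.card_fin] at *
    rw [← Real.exp_nat_mul] at h1
    calc _ ≤ (Real.exp (-L i) * Real.exp (μ.real (E i) * m / 4)) *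
        Real.exp (m * -(μ.real (E i) / 4)) := by
          apply mul_le_mul_of_nonneg_left h1 (by positivity)
      _ = Real.exp (-L i) := by
          rw [← Real.exp_add, ← Real.exp_add]; congr 1; ring
  obtain ⟨ξ, hξ⟩ := exists_le_integral (μ := ν) (f := fun ξ => ∑ i, T i ξ)
    (integrable_finsetSum _ (fun i _ => hint i))
  rw [integral_finsetSum _ (fun i _ => hint i)] at hξ
  have hlt : ∑ i, T i ξ < 1 := lt_of_le_of_lt (hξ.trans (Finset.sum_le_sum fun i _ => hle i)) hL
  refine ⟨ξ, fun i => ?_⟩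
  have hpos : ∀ i, 0 ≤ T i ξ := fun i => by simp only [T]; positivity
  have h1 : T i ξ < 1 :=
    lt_of_le_of_lt (Finset.single_le_sum (fun i _ => hpos i) (Finset.mem_univ i)) hlt
  simp only [T] at h1
  rw [← Real.exp_sum, ← Real.exp_add, ← Real.exp_add, Real.exp_lt_one_iff, Finset.sum_neg_distrib] at h1
  have hm' : (0:ℝ) < m := by exact_mod_cast hm
  set Z := ∑ j, (E i).indicator (fun _ => (1:ℝ)) (ξ j)
  have : 4 * ((m:ℝ)⁻¹ * Z) + 4 * L i / m = (4 * Z + 4 * L i) / m := by field_simp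
  rw [this, le_div_iff₀ hm']
  linarith

lemma exp_le_cosh_aux {y b : ℝ} (hb : 0 < b) (hy : |y| ≤ b) :
    Real.exp y ≤ Real.cosh b + y / b * Real.sinh b := by
  obtain ⟨h1, h2⟩ := abs_le.1 hy
  have hcc := convexOn_exp.2 (Set.mem_univ b) (Set.mem_univ (-b))
  have hc := @hcc ((1 + y / b) / 2) ((1 - y / b) / 2)
    (by have : -1 ≤ y / b := by rw [le_div_iff₀ hb]; linarith
        linarith)
    (by have : y / b ≤ 1 := by rw [div_le_iff₀ hb]; linarith
        linarith) (by ring)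
  simp only [smul_eq_mul] at hc
  have e1 : (1 + y / b) / 2 * b + (1 - y / b) / 2 * -b = y := by field_simp; ring
  rw [e1] at hc
  rw [Real.cosh_eq, Real.sinh_eq]
  linarith

lemma mgf_bound {α : Type*} [Fintype α] (w Y : α → ℝ) (hw : ∀ a, 0 ≤ w a) (hw1 : ∑ a, w a = 1)
    (hY : ∑ a, w a * Y a = 0) {B l : ℝ} (hB : 0 < B) (hl : 0 < l) (hYB : ∀ a, |Y a| ≤ B) :
    ∑ a, w a * Real.exp (l * Y a) ≤ Real.exp (l ^ 2 * B ^ 2 / 2) := by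
  have h1 : ∀ a, w a * Real.exp (l * Y a) ≤
      w a * Real.cosh (l * B) + (w a * Y a) * (1 / B * Real.sinh (l * B)) := by
    intro a
    have h := exp_le_cosh_aux (y := l * Y a) (b := l * B) (by positivity)
      (by rw [abs_mul, abs_of_pos hl]; exact mul_le_mul_of_nonneg_left (hYB a) hl.le)
    have e : l * Y a / (l * B) = Y a * (1 / B) := by field_simp
    rw [e] at h
    have := mul_le_mul_of_nonneg_left h (hw a)
    linarith
  calc _ ≤ ∑ a, (w a * Real.cosh (l * B) + (w a * Y a) * (1 / B * Real.sinh (l * B))) :=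
        Finset.sum_le_sum fun a _ => h1 a
    _ = Real.cosh (l * B) := by
        rw [Finset.sum_add_distrib, ← Finset.sum_mul, ← Finset.sum_mul, hw1, hY]; ring
    _ ≤ Real.exp ((l * B) ^ 2 / 2) := Real.cosh_le_exp_half_sq _
    _ = _ := by congr 1; ring

lemma tail_bound {α : Type*} [Fintype α] (w Y : α → ℝ) (hw : ∀ a, 0 ≤ w a) (hw1 : ∑ a, w a = 1)
    (hY : ∑ a, w a * Y a = 0) {B s : ℝ} (hB : 0 < B) (hs : 0 < s) (hYB : ∀ a, |Y a| ≤ B)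
    {r : ℕ} (hr : 0 < r) :
    ∑ τ : Fin r → α, (∏ k, w (τ k)) *
      (Set.Ioi (s / 2)).indicator (fun _ => (1:ℝ)) ((r:ℝ)⁻¹ * ∑ k, Y (τ k)) ≤
      Real.exp (-(r * s ^ 2 / (8 * B ^ 2))) := by
  have hr' : (0:ℝ) < r := by exact_mod_cast hr
  set l := s / (2 * B ^ 2) with hl
  have hl0 : 0 < l := by positivity
  have h1 : ∀ τ : Fin r → α, (∏ k, w (τ k)) *
      (Set.Ioi (s / 2)).indicator (fun _ => (1:ℝ)) ((r:ℝ)⁻¹ * ∑ k, Y (τ k)) ≤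
      (∏ k, w (τ k) * Real.exp (l * Y (τ k))) * Real.exp (-(l * r * s / 2)) := by
    intro τ
    rw [Finset.prod_mul_distrib, mul_assoc]
    apply mul_le_mul_of_nonneg_left _ (Finset.prod_nonneg fun k _ => hw _)
    rw [← Real.exp_sum, ← Real.exp_add, ← Finset.mul_sum]
    by_cases hc : (r:ℝ)⁻¹ * ∑ k, Y (τ k) ∈ Set.Ioi (s / 2)
    · rw [Set.indicator_of_mem hc]
      apply Real.one_le_exp
      rw [Set.mem_Ioi] at hc
      have : s / 2 * r ≤ ∑ k, Y (τ k) := by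
        rw [inv_mul_eq_div, lt_div_iff₀ hr'] at hc; exact hc.le
      nlinarith
    · rw [Set.indicator_of_notMem hc]; positivity
  calc _ ≤ ∑ τ : Fin r → α, (∏ k, w (τ k) * Real.exp (l * Y (τ k))) * Real.exp (-(l * r * s / 2)) :=
        Finset.sum_le_sum fun τ _ => h1 τ
    _ = (∑ a, w a * Real.exp (l * Y a)) ^ r * Real.exp (-(l * r * s / 2)) := by
        rw [← Finset.sum_mul, Fintype.sum_pow]
    _ ≤ (Real.exp (l ^ 2 * B ^ 2 / 2)) ^ r * Real.exp (-(l * r * s / 2)) := by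
        apply mul_le_mul_of_nonneg_right _ (Real.exp_pos _).le
        apply pow_le_pow_left₀ _ (mgf_bound w Y hw hw1 hY hB hl0 hYB)
        exact Finset.sum_nonneg fun a _ => mul_nonneg (hw a) (Real.exp_pos _).le
    _ = _ := by
        rw [← Real.exp_nat_mul, ← Real.exp_add, hl]; congr 1; field_simp; ring

lemma maurey_point {α : Type*} [Fintype α] (w : α → ℝ) (h : α → ℂ) (f : ℂ)
    (hw : ∀ a, 0 ≤ w a) (hw1 : ∑ a, w a = 1)
    (hf : ∑ a, (w a : ℂ) * h a = f) {S s : ℝ} (hS : 0 < S) (hs : 0 < s)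
    (hfS : ‖f‖ ≤ S) (hhS : ∀ a, ‖h a‖ ≤ 2 * S) {r : ℕ} (hr : 0 < r) :
    ∑ τ : Fin r → α, (∏ k, w (τ k)) *
      (Set.Ioi s).indicator (fun _ => (1:ℝ)) ‖f - (r:ℂ)⁻¹ * ∑ k, h (τ k)‖ ≤
      4 * Real.exp (-(r * s ^ 2 / (72 * S ^ 2))) := by
  have hr' : (0:ℝ) < r := by exact_mod_cast hr
  have hrc : (r:ℂ) ≠ 0 := by exact_mod_cast hr.ne'
  have hb : ∀ a, ‖f - h a‖ ≤ 3 * S := fun a => by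
    have := norm_sub_le f (h a); linarith [hhS a]
  have hw1c : ∑ a, (w a : ℂ) = 1 := by exact_mod_cast hw1
  have hz : ∑ a, (w a : ℂ) * (f - h a) = 0 := by
    simp only [mul_sub, Finset.sum_sub_distrib, ← Finset.sum_mul, hw1c, hf]; ring
  have hre : ∑ a, w a * (f - h a).re = 0 := by
    have := congrArg Complex.re hz
    simpa using this
  have him : ∑ a, w a * (f - h a).im = 0 := by
    have := congrArg Complex.im hz
    simpa using this
  have hexp : (r * s ^ 2 / (8 * (3 * S) ^ 2)) = r * s ^ 2 / (72 * S ^ 2) := by ring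
  have t1 := tail_bound w (fun a => (f - h a).re) hw hw1 hre (B := 3 * S) (by positivity) hs
    (fun a => (Complex.abs_re_le_norm _).trans (hb a)) hr
  have t2 := tail_bound w (fun a => -(f - h a).re) hw hw1 (by simp only [mul_neg, Finset.sum_neg_distrib, hre, neg_zero]) (B := 3 * S) (by positivity) hs
    (fun a => by rw [abs_neg]; exact (Complex.abs_re_le_norm _).trans (hb a)) hr
  have t3 := tail_bound w (fun a => (f - h a).im) hw hw1 him (B := 3 * S) (by positivity) hs
    (fun a => (Complex.abs_im_le_norm _).trans (hb a)) hr
  have t4 := tail_bound w (fun a => -(f - h a).im) hw hw1 (by simp only [mul_neg, Finset.sum_neg_distrib, him, neg_zero]) (B := 3 * S) (by positivity) hs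
    (fun a => by rw [abs_neg]; exact (Complex.abs_im_le_norm _).trans (hb a)) hr
  rw [hexp] at t1 t2 t3 t4
  have key : ∀ τ : Fin r → α, (Set.Ioi s).indicator (fun _ => (1:ℝ)) ‖f - (r:ℂ)⁻¹ * ∑ k, h (τ k)‖ ≤
      (Set.Ioi (s / 2)).indicator (fun _ => (1:ℝ)) ((r:ℝ)⁻¹ * ∑ k, (f - h (τ k)).re) +
      (Set.Ioi (s / 2)).indicator (fun _ => (1:ℝ)) ((r:ℝ)⁻¹ * ∑ k, -(f - h (τ k)).re) +
      (Set.Ioi (s / 2)).indicator (fun _ => (1:ℝ)) ((r:ℝ)⁻¹ * ∑ k, (f - h (τ k)).im) +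
      (Set.Ioi (s / 2)).indicator (fun _ => (1:ℝ)) ((r:ℝ)⁻¹ * ∑ k, -(f - h (τ k)).im) := by
    intro τ
    set z := f - (r:ℂ)⁻¹ * ∑ k, h (τ k) with hzdef
    have ez : z = ((r:ℝ)⁻¹ : ℝ) * ∑ k, (f - h (τ k)) := by
      rw [hzdef, Finset.sum_sub_distrib]; simp; field_simp
    have e1 : (r:ℝ)⁻¹ * ∑ k, (f - h (τ k)).re = z.re := by
      rw [ez, Complex.re_ofReal_mul, Complex.re_sum]
    have e3 : (r:ℝ)⁻¹ * ∑ k, (f - h (τ k)).im = z.im := by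
      rw [ez, Complex.im_ofReal_mul, Complex.im_sum]
    rw [Finset.sum_neg_distrib, Finset.sum_neg_distrib, mul_neg, mul_neg, e1, e3]
    have hn := Complex.norm_le_abs_re_add_abs_im z
    have nn : ∀ y : ℝ, 0 ≤ (Set.Ioi (s / 2)).indicator (fun _ => (1:ℝ)) y := fun y =>
      Set.indicator_nonneg (fun _ _ => zero_le_one) _
    have n1 := nn z.re
    have n2 := nn (-z.re)
    have n3 := nn z.im
    have n4 := nn (-z.im)
    have one : ∀ y : ℝ, s / 2 < y → (Set.Ioi (s / 2)).indicator (fun _ => (1:ℝ)) y = 1 := fun y hy =>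
      Set.indicator_of_mem (Set.mem_Ioi.2 hy) _
    by_cases hc : ‖z‖ ∈ Set.Ioi s
    · rw [Set.indicator_of_mem hc]
      rw [Set.mem_Ioi] at hc
      rcases lt_or_ge (s / 2) |z.re| with h' | h'
      · rcases lt_abs.1 h' with h'' | h''
        · rw [one _ h'']; linarith
        · rw [one _ h'']; linarith
      · have h2 : s / 2 < |z.im| := by linarith
        rcases lt_abs.1 h2 with h'' | h''
        · rw [one _ h'']; linarith
        · rw [one _ h'']; linarith
    · rw [Set.indicator_of_notMem hc]; linarith
  calc _ ≤ ∑ τ : Fin r → α, (∏ k, w (τ k)) * _ :=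
        Finset.sum_le_sum fun τ _ => mul_le_mul_of_nonneg_left (key τ)
          (Finset.prod_nonneg fun k _ => hw _)
    _ ≤ _ := by
        simp only [mul_add, Finset.sum_add_distrib]
        linarith

/-- the four units -/
def un : Fin 4 → ℂ := ![1, Complex.I, -1, -Complex.I]

/-- coefficients -/
def cf (z : ℂ) : Fin 4 → ℝ := ![max z.re 0, max z.im 0, max (-z.re) 0, max (-z.im) 0]

lemma cf_nonneg (z : ℂ) (k : Fin 4) : 0 ≤ cf z k := by
  fin_cases k <;> simp [cf]

lemma cf_sum (z : ℂ) : ∑ k, cf z k ≤ 2 * ‖z‖ := by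
  have h1 := Complex.abs_re_le_norm z
  have h2 := Complex.abs_im_le_norm z
  have h3 : ∀ y : ℝ, max y 0 + max (-y) 0 = |y| := by
    intro y
    rcases le_total 0 y with h | h
    · rw [max_eq_left h, max_eq_right (by linarith), abs_of_nonneg h]; ring
    · rw [max_eq_right h, max_eq_left (by linarith), abs_of_nonpos h]; ring
  have e : ∑ k, cf z k = |z.re| + |z.im| := by
    rw [Fin.sum_univ_four]; simp [cf]; linarith [h3 z.re, h3 z.im]
  rw [e]; linarith

lemma cf_un (z : ℂ) : ∑ k, (cf z k : ℂ) * un k = z := by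
  have h3 : ∀ y : ℝ, max y 0 - max (-y) 0 = y := by
    intro y
    rcases le_total 0 y with h | h
    · rw [max_eq_left h, max_eq_right (by linarith)]; ring
    · rw [max_eq_right h, max_eq_left (by linarith)]; ring
  rw [Fin.sum_univ_four]
  apply Complex.ext
  · simp [cf, un]; linarith [h3 z.re]
  · simp [cf, un]; linarith [h3 z.im]

lemma un_norm (k : Fin 4) : ‖un k‖ = 1 := by
  fin_cases k <;> simp [un]

/-- atoms -/
def atomv {N : ℕ} (S : ℝ) (g : Fin N → ℂ) : Option (Fin N × Fin 4) → ℂ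
  | none => 0
  | some b => 2 * S * un b.2 * g b.1

lemma atomv_norm {N : ℕ} {S : ℝ} (hS : 0 < S) (g : Fin N → ℂ) (hg : ∀ i, ‖g i‖ ≤ 1) (b) :
    ‖atomv S g b‖ ≤ 2 * S := by
  cases b with
  | none => simp [atomv]; linarith
  | some b =>
    simp only [atomv, norm_mul, un_norm]
    simp [abs_of_pos hS]
    nlinarith [hg b.1]

lemma exists_weights {N : ℕ} (a : Fin N → ℂ) {S : ℝ} (hS : 0 < S) (ha : ∑ i, ‖a i‖ ≤ S) :
    ∃ w : Option (Fin N × Fin 4) → ℝ, (∀ b, 0 ≤ w b) ∧ ∑ b, w b = 1 ∧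
      ∀ g : Fin N → ℂ, ∑ b, (w b : ℂ) * atomv S g b = ∑ i, a i * g i := by
  have hsum : ∑ b : Fin N × Fin 4, cf (a b.1) b.2 / (2 * S) ≤ 1 := by
    rw [← Finset.sum_div, div_le_one (by positivity), Fintype.sum_prod_type]
    calc _ ≤ ∑ i, 2 * ‖a i‖ := Finset.sum_le_sum fun i _ => cf_sum (a i)
      _ ≤ 2 * S := by rw [← Finset.mul_sum]; linarith
  refine ⟨fun b => Option.elim b (1 - ∑ b : Fin N × Fin 4, cf (a b.1) b.2 / (2 * S))
    (fun b => cf (a b.1) b.2 / (2 * S)), ?_, ?_, ?_⟩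
  · intro b
    cases b with
    | none => simp only [Option.elim]; linarith
    | some b => simp only [Option.elim]; exact div_nonneg (cf_nonneg _ _) (by positivity)
  · rw [Fintype.sum_option]; simp only [Option.elim]; ring
  · intro g
    rw [Fintype.sum_option]
    simp only [Option.elim, atomv, mul_zero, zero_add]
    rw [Fintype.sum_prod_type]
    refine Finset.sum_congr rfl fun i _ => ?_
    conv_rhs => rw [← cf_un (a i)]
    rw [Finset.sum_mul]
    refine Finset.sum_congr rfl fun k _ => ?_
    have : (S : ℂ) ≠ 0 := by exact_mod_cast hS.ne'
    push_cast
    field_simp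

/-- the empirical functions -/
def gt {X : Type*} {N r : ℕ} (S : ℝ) (g : Fin N → X → ℂ) (τ : Fin r → Option (Fin N × Fin 4))
    (x : X) : ℂ := (r:ℂ)⁻¹ * ∑ k, atomv S (fun i => g i x) (τ k)

lemma gt_meas {X : Type*} [MeasurableSpace X] {N r : ℕ} (S : ℝ) (g : Fin N → X → ℂ)
    (hg : ∀ i, Measurable (g i)) (τ : Fin r → Option (Fin N × Fin 4)) :
    Measurable (gt S g τ) := by
  unfold gt
  apply Measurable.const_mul
  apply Finset.measurable_sum
  intro k _
  cases τ k with
  | none => simp only [atomv]; exact measurable_const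
  | some b => simp only [atomv]; exact (hg b.1).const_mul _

/-- empirical frequency -/
def emp {X : Type*} {m : ℕ} (ξ : Fin m → X) (E : Set X) : ℝ :=
  (m:ℝ)⁻¹ * ∑ j, E.indicator (fun _ => (1:ℝ)) (ξ j)

lemma ind_le {X : Type*} {E E1 E2 : Set X} (h : E ⊆ E1 ∪ E2) (x : X) :
    E.indicator (fun _ => (1:ℝ)) x ≤ E1.indicator (fun _ => (1:ℝ)) x +
      E2.indicator (fun _ => (1:ℝ)) x := by
  have n1 : 0 ≤ E1.indicator (fun _ => (1:ℝ)) x := Set.indicator_nonneg (fun _ _ => zero_le_one) _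
  have n2 : 0 ≤ E2.indicator (fun _ => (1:ℝ)) x := Set.indicator_nonneg (fun _ _ => zero_le_one) _
  by_cases hx : x ∈ E
  · rw [Set.indicator_of_mem hx]
    rcases h hx with h' | h'
    · rw [Set.indicator_of_mem h']; linarith
    · rw [Set.indicator_of_mem h' (f := fun _ => (1:ℝ))]; linarith
  · rw [Set.indicator_of_notMem hx]; linarith

lemma emp_le {X : Type*} {m : ℕ} (ξ : Fin m → X) {E E1 E2 : Set X} (h : E ⊆ E1 ∪ E2) :
    emp ξ E ≤ emp ξ E1 + emp ξ E2 := by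
  unfold emp
  rw [← mul_add, ← Finset.sum_add_distrib]
  apply mul_le_mul_of_nonneg_left _ (by positivity)
  exact Finset.sum_le_sum fun j _ => ind_le h _

lemma emp_nonneg {X : Type*} {m : ℕ} (ξ : Fin m → X) (E : Set X) : 0 ≤ emp ξ E := by
  unfold emp
  apply mul_nonneg (by positivity)
  exact Finset.sum_nonneg fun j _ => Set.indicator_nonneg (fun _ _ => zero_le_one) _

lemma maurey_choice {X : Type*} [MeasurableSpace X] (μ : Measure X) [IsProbabilityMeasure μ]
    {m N : ℕ} (hm : 0 < m) (ξ : Fin m → X) (g : Fin N → X → ℂ) (hg : ∀ i, Measurable (g i))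
    (hg1 : ∀ i x, ‖g i x‖ ≤ 1) (a : Fin N → ℂ) {S s : ℝ} (hS : 0 < S) (ha : ∑ i, ‖a i‖ ≤ S)
    (hs : 0 < s) {r : ℕ} (hr : 0 < r) :
    ∃ τ : Fin r → Option (Fin N × Fin 4),
      μ.real {x | s < ‖∑ i, a i * g i x - gt S g τ x‖} +
        emp ξ {x | s < ‖∑ i, a i * g i x - gt S g τ x‖} ≤
      8 * Real.exp (-(r * s ^ 2 / (72 * S ^ 2))) := by
  obtain ⟨w, hw, hw1, hwf⟩ := exists_weights a hS ha
  set δ := 4 * Real.exp (-(r * s ^ 2 / (72 * S ^ 2))) with hδ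
  let D : (Fin r → Option (Fin N × Fin 4)) → Set X :=
    fun τ => {x | s < ‖∑ i, a i * g i x - gt S g τ x‖}
  have hD : ∀ τ, MeasurableSet (D τ) := fun τ =>
    measurableSet_lt measurable_const
      ((Finset.measurable_sum _ (fun i _ => (hg i).const_mul _)).sub (gt_meas S g hg τ)).norm
  let W : (Fin r → Option (Fin N × Fin 4)) → ℝ := fun τ => ∏ k, w (τ k)
  have hW : ∀ τ, 0 ≤ W τ := fun τ => Finset.prod_nonneg fun k _ => hw _
  have hW1 : ∑ τ, W τ = 1 := by
    simp only [W]; rw [← Fintype.sum_pow, hw1, one_pow]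
  have pt : ∀ x, ∑ τ, W τ * (D τ).indicator (fun _ => (1:ℝ)) x ≤ δ := by
    intro x
    have hfx : ‖∑ i, a i * g i x‖ ≤ S := by
      refine (norm_sum_le _ _).trans (le_trans (Finset.sum_le_sum fun i _ => ?_) ha)
      rw [norm_mul]; nlinarith [hg1 i x, norm_nonneg (a i)]
    have := maurey_point w (atomv S (fun i => g i x)) (∑ i, a i * g i x) hw hw1
      (hwf _) hS hs hfx (atomv_norm hS _ (fun i => hg1 i x)) hr
    exact this
  have hiD : ∀ τ, Integrable ((D τ).indicator (fun _ => (1:ℝ))) μ := fun τ =>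
    (integrable_const (1:ℝ)).indicator (hD τ)
  have h1 : ∑ τ, W τ * μ.real (D τ) ≤ δ := by
    have e : ∫ x, ∑ τ, W τ * (D τ).indicator (fun _ => (1:ℝ)) x ∂μ = ∑ τ, W τ * μ.real (D τ) := by
      rw [integral_finsetSum _ (fun τ _ => (hiD τ).const_mul _)]
      refine Finset.sum_congr rfl fun τ _ => ?_
      rw [integral_const_mul, integral_indicator (hD τ)]
      simp
    rw [← e]
    calc _ ≤ ∫ x, δ ∂μ := integral_mono
          (integrable_finsetSum _ (fun τ _ => (hiD τ).const_mul _)) (integrable_const _) pt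
      _ = δ := by simp
  have hm' : (0:ℝ) < m := by exact_mod_cast hm
  have h2 : ∑ τ, W τ * emp ξ (D τ) ≤ δ := by
    have e : ∑ τ, W τ * emp ξ (D τ) =
        (m:ℝ)⁻¹ * ∑ j, ∑ τ, W τ * (D τ).indicator (fun _ => (1:ℝ)) (ξ j) := by
      rw [Finset.sum_comm, Finset.mul_sum]
      refine Finset.sum_congr rfl fun τ _ => ?_
      unfold emp
      rw [← Finset.mul_sum]; ring
    rw [e]
    calc _ ≤ (m:ℝ)⁻¹ * ∑ j : Fin m, δ :=
          mul_le_mul_of_nonneg_left (Finset.sum_le_sum fun j _ => pt _) (by positivity)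
      _ = δ := by simp; field_simp
  by_contra hcon
  push Not at hcon
  have h3 : ∀ τ, 2 * δ < μ.real (D τ) + emp ξ (D τ) := fun τ => by
    have := hcon τ
    simp only [D]; linarith
  have h4 : ∑ τ, W τ * (μ.real (D τ) + emp ξ (D τ) - 2 * δ) ≤ 0 := by
    simp only [mul_sub, mul_add, Finset.sum_sub_distrib, Finset.sum_add_distrib, ← Finset.sum_mul, hW1]
    linarith
  have h5 : ∑ τ, W τ * (μ.real (D τ) + emp ξ (D τ) - 2 * δ) = 0 :=
    le_antisymm h4 (Finset.sum_nonneg fun τ _ => mul_nonneg (hW τ) (by linarith [h3 τ]))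
  rw [Finset.sum_eq_zero_iff_of_nonneg
    (fun τ _ => mul_nonneg (hW τ) (by linarith [h3 τ]))] at h5
  have h6 : ∀ τ, W τ = 0 := fun τ => by
    rcases mul_eq_zero.1 (h5 τ (Finset.mem_univ _)) with h | h
    · exact h
    · linarith [h3 τ]
  simp [h6] at hW1

lemma level {X : Type*} [MeasurableSpace X] (μ : Measure X) [IsProbabilityMeasure μ]
    {m N : ℕ} (hm : 0 < m) (ξ : Fin m → X) (g : Fin N → X → ℂ) (hg : ∀ i, Measurable (g i))
    (hg1 : ∀ i x, ‖g i x‖ ≤ 1) (a : Fin N → ℂ) {S s : ℝ} (hS : 0 < S) (ha : ∑ i, ‖a i‖ ≤ S)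
    (hs : 0 < s) {r : ℕ} (hr : 0 < r) {η : ℝ}
    (hξ : ∀ τ : Fin r → Option (Fin N × Fin 4), μ.real {x | 2 * s ≤ ‖gt S g τ x‖} ≤
      4 * emp ξ {x | 2 * s ≤ ‖gt S g τ x‖} + η) :
    μ.real {x | 3 * s ≤ ‖∑ i, a i * g i x‖} ≤ 4 * emp ξ {x | s ≤ ‖∑ i, a i * g i x‖} +
      32 * Real.exp (-(r * s ^ 2 / (72 * S ^ 2))) + η := by
  obtain ⟨τ, hτ⟩ := maurey_choice μ hm ξ g hg hg1 a hS ha hs hr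
  set D := {x | s < ‖∑ i, a i * g i x - gt S g τ x‖} with hD
  set E := {x | 2 * s ≤ ‖gt S g τ x‖} with hE
  have h1 : {x | 3 * s ≤ ‖∑ i, a i * g i x‖} ⊆ E ∪ D := by
    intro x hx
    by_cases hc : x ∈ D
    · exact Or.inr hc
    · left
      simp only [hD, Set.mem_ofPred_eq, not_lt, hE] at hc hx ⊢
      have := norm_sub_norm_le (∑ i, a i * g i x) (gt S g τ x)
      linarith
  have h2 : E ⊆ {x | s ≤ ‖∑ i, a i * g i x‖} ∪ D := by
    intro x hx
    by_cases hc : x ∈ D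
    · exact Or.inr hc
    · left
      simp only [hD, Set.mem_ofPred_eq, not_lt, hE] at hc hx ⊢
      have := norm_sub_norm_le (gt S g τ x) (∑ i, a i * g i x)
      rw [norm_sub_rev] at this
      linarith
  have h3 : μ.real {x | 3 * s ≤ ‖∑ i, a i * g i x‖} ≤ μ.real E + μ.real D :=
    (measureReal_mono h1).trans (measureReal_union_le _ _)
  have h4 := emp_le ξ h2
  have h5 := hξ τ
  have h6 : 0 ≤ μ.real D := measureReal_nonneg
  linarith

lemma layer_upper {S y p : ℝ} (hS : 0 < S) (hp : 0 ≤ p) (hy : 0 ≤ y) (hyS : y ≤ S) (J : ℕ) :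
    y ^ p ≤ (S * (3⁻¹) ^ J) ^ p + ∑ i ∈ Finset.range J, (S * (3⁻¹) ^ i) ^ p *
      (Set.Ici (3 * (S * (3⁻¹) ^ i / 9))).indicator (fun _ => (1:ℝ)) y := by
  induction J with
  | zero => simpa using Real.rpow_le_rpow hy hyS hp
  | succ J ih =>
    rw [Finset.sum_range_succ]
    by_cases hc : y ∈ Set.Ici (3 * (S * (3⁻¹) ^ J / 9))
    · rw [Set.indicator_of_mem hc]
      have : 0 ≤ (S * (3⁻¹) ^ (J + 1)) ^ p := by positivity
      linarith
    · have h1 : y ≤ S * (3⁻¹) ^ (J + 1) := by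
        rw [Set.mem_Ici, not_le] at hc
        rw [pow_succ]; linarith
      have h2 := Real.rpow_le_rpow hy h1 hp
      have h3 : 0 ≤ ∑ i ∈ Finset.range J, (S * (3⁻¹) ^ i) ^ p *
        (Set.Ici (3 * (S * (3⁻¹) ^ i / 9))).indicator (fun _ => (1:ℝ)) y :=
        Finset.sum_nonneg fun i _ => mul_nonneg (by positivity)
          (Set.indicator_nonneg (fun _ _ => zero_le_one) _)
      rw [Set.indicator_of_notMem hc]
      linarith

lemma layer_lower {z p : ℝ} (hp : 1 ≤ p) (hz : 0 ≤ z) (J : ℕ) : ∀ S : ℝ, 0 < S →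
    ∑ i ∈ Finset.range J, (S * (3⁻¹) ^ i) ^ p *
      (Set.Ici (S * (3⁻¹) ^ i)).indicator (fun _ => (1:ℝ)) z ≤ 2 * (min S z) ^ p := by
  induction J with
  | zero => intro S hS; simp; positivity
  | succ J ih =>
    intro S hS
    rw [Finset.sum_range_succ']
    have h := ih (S * 3⁻¹) (by positivity)
    have e : ∀ i : ℕ, S * 3⁻¹ * (3⁻¹) ^ i = S * (3⁻¹) ^ (i + 1) := fun i => by rw [pow_succ]; ring
    simp only [e] at h
    simp only [pow_zero, mul_one]
    by_cases hc : z ∈ Set.Ici S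
    · rw [Set.indicator_of_mem hc]
      rw [Set.mem_Ici] at hc
      rw [min_eq_left hc]
      have h1 : (min (S * 3⁻¹) z) ^ p ≤ (S * 3⁻¹) ^ p :=
        Real.rpow_le_rpow (le_min (by positivity) hz) (min_le_left _ _) (by linarith)
      have h2 : (S * 3⁻¹) ^ p ≤ S ^ p * 3⁻¹ := by
        rw [Real.mul_rpow hS.le (by norm_num)]
        apply mul_le_mul_of_nonneg_left _ (by positivity)
        calc ((3:ℝ)⁻¹) ^ p ≤ (3⁻¹) ^ (1:ℝ) :=
              Real.rpow_le_rpow_of_exponent_ge (by norm_num) (by norm_num) hp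
          _ = 3⁻¹ := Real.rpow_one _
      have h3 : 0 ≤ S ^ p := by positivity
      linarith
    · rw [Set.indicator_of_notMem hc]
      rw [Set.mem_Ici, not_le] at hc
      rw [min_eq_right hc.le]
      have h1 : (min (S * 3⁻¹) z) ^ p ≤ z ^ p :=
        Real.rpow_le_rpow (le_min (by positivity) hz) (min_le_right _ _) (by linarith)
      linarith

lemma disc_core {X : Type*} [MeasurableSpace X] (μ : Measure X) [IsProbabilityMeasure μ]
    {m : ℕ} (hm : 0 < m) (ξ : Fin m → X) (f : X → ℂ) (hf : Measurable f) {S p : ℝ} (hS : 0 < S)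
    (hp : 2 < p) (hfS : ∀ x, ‖f x‖ ≤ S) (J : ℕ) (ε : ℕ → ℝ)
    (hlev : ∀ i < J, μ.real {x | 3 * (S * (3⁻¹) ^ i / 9) ≤ ‖f x‖} ≤
      4 * emp ξ {x | (S * (3⁻¹) ^ i / 9) ≤ ‖f x‖} + ε i)
    (herr : ∑ i ∈ Finset.range J, (S * (3⁻¹) ^ i) ^ p * ε i ≤ 1 / 4)
    (hJ : (S * (3⁻¹) ^ J) ^ p ≤ 1 / 4) (hnorm : ∫ x, ‖f x‖ ^ p ∂μ = 1) :
    1 ≤ (36:ℝ) ^ p * ((m:ℝ)⁻¹ * ∑ j, ‖f (ξ j)‖ ^ p) := by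
  have hm' : (0:ℝ) < m := by exact_mod_cast hm
  let E : ℕ → Set X := fun i => {x | 3 * (S * (3⁻¹) ^ i / 9) ≤ ‖f x‖}
  have hE : ∀ i, MeasurableSet (E i) := fun i => measurableSet_le measurable_const hf.norm
  have hiE : ∀ i, Integrable ((E i).indicator (fun _ => (1:ℝ))) μ := fun i =>
    (integrable_const (1:ℝ)).indicator (hE i)
  have hif : Integrable (fun x => ‖f x‖ ^ p) μ := by
    by_contra h
    rw [integral_undef h] at hnorm
    norm_num at hnorm
  have u1 : 1 ≤ (S * (3⁻¹) ^ J) ^ p + ∑ i ∈ Finset.range J, (S * (3⁻¹) ^ i) ^ p * μ.real (E i) := by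
    have e : ∫ x, ((S * (3⁻¹) ^ J) ^ p + ∑ i ∈ Finset.range J, (S * (3⁻¹) ^ i) ^ p *
        (E i).indicator (fun _ => (1:ℝ)) x) ∂μ =
        (S * (3⁻¹) ^ J) ^ p + ∑ i ∈ Finset.range J, (S * (3⁻¹) ^ i) ^ p * μ.real (E i) := by
      rw [integral_add (integrable_const _)
        (integrable_finsetSum _ (fun i _ => (hiE i).const_mul _)),
        integral_finsetSum _ (fun i _ => (hiE i).const_mul _)]
      congr 1
      · simp
      · refine Finset.sum_congr rfl fun i _ => ?_
        rw [integral_const_mul, integral_indicator (hE i)]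
        simp
    rw [← e]
    refine hnorm.symm.le.trans ?_
    apply integral_mono hif
    · exact (integrable_const _).add (integrable_finsetSum _ (fun i _ => (hiE i).const_mul _))
    · intro x
      exact layer_upper hS (by linarith) (norm_nonneg (f x)) (hfS x) J
  have l1 : ∑ i ∈ Finset.range J, (S * (3⁻¹) ^ i) ^ p * emp ξ {x | (S * (3⁻¹) ^ i / 9) ≤ ‖f x‖} ≤
      2 * 9 ^ p * ((m:ℝ)⁻¹ * ∑ j, ‖f (ξ j)‖ ^ p) := by
    have e : ∑ i ∈ Finset.range J, (S * (3⁻¹) ^ i) ^ p * emp ξ {x | (S * (3⁻¹) ^ i / 9) ≤ ‖f x‖} =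
        (m:ℝ)⁻¹ * ∑ j, ∑ i ∈ Finset.range J, (S * (3⁻¹) ^ i) ^ p *
          ({x | (S * (3⁻¹) ^ i / 9) ≤ ‖f x‖} : Set X).indicator (fun _ => (1:ℝ)) (ξ j) := by
      rw [Finset.sum_comm, Finset.mul_sum]
      refine Finset.sum_congr rfl fun i _ => ?_
      unfold emp
      rw [← Finset.mul_sum]; ring
    rw [e]
    have : ∀ j, ∑ i ∈ Finset.range J, (S * (3⁻¹) ^ i) ^ p *
          ({x | (S * (3⁻¹) ^ i / 9) ≤ ‖f x‖} : Set X).indicator (fun _ => (1:ℝ)) (ξ j) ≤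
          2 * 9 ^ p * ‖f (ξ j)‖ ^ p := by
      intro j
      have h := layer_lower (z := 9 * ‖f (ξ j)‖) (p := p) (by linarith) (by positivity) J S hS
      have h2 : (min S (9 * ‖f (ξ j)‖)) ^ p ≤ (9 * ‖f (ξ j)‖) ^ p :=
        Real.rpow_le_rpow (le_min (by positivity) (by positivity)) (min_le_right _ _) (by linarith)
      rw [Real.mul_rpow (by norm_num) (norm_nonneg _)] at h2
      refine le_trans (le_of_eq ?_) (h.trans (by linarith))
      refine Finset.sum_congr rfl fun i _ => ?_
      congr 1
      simp only [Set.indicator_apply]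
      congr 1
      simp only [Set.mem_ofPred_eq, Set.mem_Ici, eq_iff_iff]
      constructor <;> intro h <;> linarith
    calc _ ≤ (m:ℝ)⁻¹ * ∑ j, 2 * 9 ^ p * ‖f (ξ j)‖ ^ p :=
          mul_le_mul_of_nonneg_left (Finset.sum_le_sum fun j _ => this j) (by positivity)
      _ = _ := by rw [← Finset.mul_sum]; ring
  have c1 : ∑ i ∈ Finset.range J, (S * (3⁻¹) ^ i) ^ p * μ.real (E i) ≤
      4 * ∑ i ∈ Finset.range J, (S * (3⁻¹) ^ i) ^ p * emp ξ {x | (S * (3⁻¹) ^ i / 9) ≤ ‖f x‖} +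
      ∑ i ∈ Finset.range J, (S * (3⁻¹) ^ i) ^ p * ε i := by
    rw [Finset.mul_sum, ← Finset.sum_add_distrib]
    refine Finset.sum_le_sum fun i hi => ?_
    have h := mul_le_mul_of_nonneg_left (hlev i (Finset.mem_range.1 hi))
      (show 0 ≤ (S * (3⁻¹) ^ i) ^ p by positivity)
    simp only [E]
    linarith
  set D := (m:ℝ)⁻¹ * ∑ j, ‖f (ξ j)‖ ^ p with hD
  have hD0 : 0 ≤ D := by positivity
  have h16 : (16:ℝ) * 9 ^ p ≤ 36 ^ p := by
    rw [show (36:ℝ) = 4 * 9 by norm_num, Real.mul_rpow (by norm_num) (by norm_num)]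
    apply mul_le_mul_of_nonneg_right _ (by positivity)
    calc (16:ℝ) = 4 ^ (2:ℝ) := by norm_num
      _ ≤ 4 ^ p := Real.rpow_le_rpow_of_exponent_le (by norm_num) hp.le
  have h17 := mul_le_mul_of_nonneg_right h16 hD0
  linarith

lemma level_num {S p : ℝ} (hS : 0 < S) (i : ℕ) :
    (S * (3⁻¹) ^ i) ^ p * 9 ^ i = S ^ p * (9 * 3 ^ (-p)) ^ i := by
  rw [Real.mul_rpow hS.le (by positivity), mul_pow, mul_assoc, mul_comm (9 ^ i)]
  congr 2
  rw [← Real.rpow_natCast, ← Real.rpow_natCast, ← Real.rpow_mul (by norm_num), ← Real.rpow_mul (by norm_num),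
    Real.inv_rpow (by norm_num), ← Real.rpow_neg (by norm_num)]
  congr 1; ring

lemma disc_points {X : Type*} [MeasurableSpace X] (μ : Measure X) [IsProbabilityMeasure μ]
    {m N : ℕ} (hm : 0 < m) (hN : 1 ≤ N) (g : Fin N → X → ℂ) (hg : ∀ i, Measurable (g i))
    (hg1 : ∀ i x, ‖g i x‖ ≤ 1) {p S : ℝ} (hp : 2 < p) (hS : 1 ≤ S)
    (hbig : 32 * 5834 * S ^ p * Real.log (512 * S ^ p) * Real.log (4 * N + 1) *
      (1 - 9 * 3 ^ (-p))⁻¹ ≤ m) :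
    ∃ ξ : Fin m → X, ∀ a : Fin N → ℂ, ∑ i, ‖a i‖ ≤ S →
      ∫ x, ‖∑ i, a i * g i x‖ ^ p ∂μ = 1 →
      1 ≤ (36:ℝ) ^ p * ((m:ℝ)⁻¹ * ∑ j, ‖∑ i, a i * g i (ξ j)‖ ^ p) := by
  have hS0 : 0 < S := by linarith
  have hm' : (0:ℝ) < m := by exact_mod_cast hm
  have hSp : 1 ≤ S ^ p := Real.one_le_rpow hS (by linarith)
  set Λ := Real.log (512 * S ^ p) with hΛ
  have hexpΛ : Real.exp Λ = 512 * S ^ p := Real.exp_log (by positivity)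
  have hΛ1 : 1 ≤ Λ := by
    rw [hΛ, Real.le_log_iff_exp_le (by positivity)]
    have := Real.exp_one_lt_d9
    linarith
  set ln := Real.log (4 * N + 1) with hln
  have hN' : (1:ℝ) ≤ N := by exact_mod_cast hN
  have hexpln : Real.exp ln = 4 * N + 1 := Real.exp_log (by positivity)
  have hln1 : 1 ≤ ln := by
    rw [hln, Real.le_log_iff_exp_le (by positivity)]
    have := Real.exp_one_lt_d9
    linarith
  have hρ1 : (9:ℝ) * 3 ^ (-p) < 1 := by
    have : (3:ℝ) ^ (-p) < 3 ^ (-2:ℝ) := Real.rpow_lt_rpow_of_exponent_lt (by norm_num) (by linarith)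
    have e : (3:ℝ) ^ (-2:ℝ) = 1 / 9 := by
      rw [Real.rpow_neg (by norm_num)]; norm_num
    rw [e] at this; linarith
  set ρ := (9:ℝ) * 3 ^ (-p) with hρ
  have hρ0 : 0 ≤ ρ := by positivity
  obtain ⟨J, hJ⟩ : ∃ J : ℕ, S * (3⁻¹) ^ J ≤ 1 / 2 := by
    obtain ⟨J, hJ⟩ := exists_pow_lt_of_lt_one (show (0:ℝ) < 1 / (2 * S) by positivity)
      (show (3:ℝ)⁻¹ < 1 by norm_num)
    refine ⟨J, ?_⟩
    rw [lt_div_iff₀ (by positivity)] at hJ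
    linarith
  have hJ' : (S * (3⁻¹) ^ J) ^ p ≤ 1 / 4 := by
    calc _ ≤ (1 / 2 : ℝ) ^ p := Real.rpow_le_rpow (by positivity) hJ (by linarith)
      _ ≤ (1 / 2 : ℝ) ^ (2:ℝ) := Real.rpow_le_rpow_of_exponent_ge (by norm_num) (by norm_num) hp.le
      _ = 1 / 4 := by norm_num
  let r : ℕ → ℕ := fun i => ⌈5832 * 9 ^ i * Λ⌉₊
  have hrlow : ∀ i, 5832 * 9 ^ i * Λ ≤ r i := fun i => Nat.le_ceil _
  have h9 : ∀ i : ℕ, (1:ℝ) ≤ 9 ^ i := fun i => one_le_pow₀ (by norm_num)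
  have h9Λ : ∀ i : ℕ, (1:ℝ) ≤ 9 ^ i * Λ := fun i => by nlinarith [h9 i]
  have hrpos : ∀ i, 0 < r i := fun i => by
    have : (0:ℝ) < r i := by linarith [hrlow i, h9Λ i]
    exact_mod_cast this
  have hrup : ∀ i, (r i : ℝ) ≤ 5833 * (9 ^ i * Λ) := fun i => by
    have := (Nat.ceil_lt_add_one (show 0 ≤ 5832 * 9 ^ i * Λ by positivity)).le
    have h := h9Λ i
    have e : (r i : ℝ) ≤ 5832 * 9 ^ i * Λ + 1 := this
    linarith
  let L : ℕ → ℝ := fun i => r i * ln + (i + 1)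
  have hLup : ∀ i, L i ≤ 5834 * (9 ^ i * Λ) * ln := fun i => by
    have h1 : ((i:ℝ) + 1) ≤ 9 ^ i := by
      have := one_add_mul_le_pow (show (-2:ℝ) ≤ 8 by norm_num) i
      norm_num at this
      have hi : (0:ℝ) ≤ i := by positivity
      linarith
    have h2 : (9:ℝ) ^ i ≤ 9 ^ i * Λ * ln := by
      have h3 : (9:ℝ) ^ i ≤ 9 ^ i * Λ := le_mul_of_one_le_right (by positivity) hΛ1
      exact h3.trans (le_mul_of_one_le_right (by linarith [h9Λ i]) hln1)
    have h4 := mul_le_mul_of_nonneg_right (hrup i) (show 0 ≤ ln by linarith)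
    simp only [L]
    linarith
  have hcard : (Fintype.card (Option (Fin N × Fin 4)) : ℝ) = Real.exp ln := by
    rw [hexpln]; simp; ring
  have hLsum : ∑ I : (Σ i : Fin J, (Fin (r i) → Option (Fin N × Fin 4))), Real.exp (-L I.1) < 1 := by
    rw [Fintype.sum_sigma]
    have e : ∀ i : Fin J, ∑ _τ : Fin (r i) → Option (Fin N × Fin 4), Real.exp (-L i) ≤
        (1/2 : ℝ) * (1 / 2) ^ (i:ℕ) := by
      intro i
      rw [Finset.sum_const, Finset.card_univ, Fintype.card_fun, Fintype.card_fin, nsmul_eq_mul]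
      push_cast
      rw [hcard, ← Real.exp_nat_mul, ← Real.exp_add]
      have e1 : (r i : ℝ) * ln + -L i = (((i:ℕ) + 1 : ℕ) : ℝ) * (-1) := by
        simp only [L]; push_cast; ring
      rw [e1, Real.exp_nat_mul, ← pow_succ']
      apply pow_le_pow_left₀ (Real.exp_pos _).le
      rw [Real.exp_neg]
      have := Real.add_one_le_exp (1:ℝ)
      rw [inv_le_comm₀ (Real.exp_pos _) (by norm_num)]
      linarith
    calc _ ≤ ∑ i : Fin J, (1/2 : ℝ) * (1 / 2) ^ (i:ℕ) := Finset.sum_le_sum fun i _ => e i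
      _ < 1 := by
        rw [Fin.sum_univ_eq_sum_range (fun i => (1/2 : ℝ) * (1 / 2) ^ i) J, ← Finset.mul_sum,
          geom_sum_eq (by norm_num)]
        have h2 : (0:ℝ) < (1 / 2) ^ J := by positivity
        generalize ((1:ℝ) / 2) ^ J = q at h2
        have e : (1 / 2 : ℝ) * ((q - 1) / (1 / 2 - 1)) = 1 - q := by ring
        rw [e]; linarith
  obtain ⟨ξ, hξ⟩ := random_pts μ (I := Σ i : Fin J, (Fin (r i) → Option (Fin N × Fin 4)))
    (fun I => {x | 2 * (S * (3⁻¹) ^ (I.1 : ℕ) / 9) ≤ ‖gt S g I.2 x‖})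
    (fun I => measurableSet_le measurable_const (gt_meas S g hg I.2).norm)
    (fun I => L I.1) hLsum m hm
  refine ⟨ξ, fun a ha hnorm => ?_⟩
  let ε : ℕ → ℝ := fun i => 32 * Real.exp (-Λ) + 4 * L i / m
  refine disc_core μ hm ξ (fun x => ∑ i, a i * g i x)
    (Finset.measurable_sum _ (fun i _ => (hg i).const_mul _)) hS0 hp ?_ J ε ?_ ?_ hJ' hnorm
  · intro x
    refine (norm_sum_le _ _).trans (le_trans (Finset.sum_le_sum fun i _ => ?_) ha)
    rw [norm_mul]; nlinarith [hg1 i x, norm_nonneg (a i)]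
  · intro i hi
    have h := level μ hm ξ g hg hg1 a hS0 ha (s := S * (3⁻¹) ^ i / 9) (by positivity) (hrpos i)
      (η := 4 * L i / m) (fun τ => hξ ⟨⟨i, hi⟩, τ⟩)
    refine h.trans ?_
    have h2 : Λ ≤ r i * (S * (3⁻¹) ^ i / 9) ^ 2 / (72 * S ^ 2) := by
      have e : (r i : ℝ) * (S * (3⁻¹) ^ i / 9) ^ 2 / (72 * S ^ 2) = r i / (5832 * 9 ^ i) := by
        have : (9:ℝ) ^ i = 3 ^ i * 3 ^ i := by rw [← mul_pow]; norm_num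
        rw [this, inv_pow]; field_simp; ring
      rw [e, le_div_iff₀ (by positivity)]
      linarith [hrlow i]
    have h3 : Real.exp (-(r i * (S * (3⁻¹) ^ i / 9) ^ 2 / (72 * S ^ 2))) ≤ Real.exp (-Λ) :=
      Real.exp_le_exp.2 (by linarith)
    simp only [ε]
    linarith
  · have s1 : ∑ i ∈ Finset.range J, (S * (3⁻¹) ^ i) ^ p ≤ 2 * S ^ p := by
      have h := layer_lower (z := S) (p := p) (by linarith) hS0.le J S hS0
      rw [min_self] at h
      refine le_trans (le_of_eq ?_) h
      refine Finset.sum_congr rfl fun i _ => ?_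
      rw [Set.indicator_of_mem, mul_one]
      rw [Set.mem_Ici]
      exact mul_le_of_le_one_right hS0.le (pow_le_one₀ (by norm_num) (by norm_num))
    have s2 : ∑ i ∈ Finset.range J, (S * (3⁻¹) ^ i) ^ p * 9 ^ i ≤ S ^ p * (1 - ρ)⁻¹ := by
      calc _ = S ^ p * ∑ i ∈ Finset.range J, ρ ^ i := by
            rw [Finset.mul_sum]; exact Finset.sum_congr rfl fun i _ => level_num hS0 i
        _ ≤ _ := by
            apply mul_le_mul_of_nonneg_left _ (by positivity)
            have hs := summable_geometric_of_lt_one hρ0 hρ1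
            rw [← tsum_geometric_of_lt_one hρ0 hρ1]
            exact hs.sum_le_tsum _ (fun i _ => by positivity)
    have s3 : ∑ i ∈ Finset.range J, (S * (3⁻¹) ^ i) ^ p * ε i ≤
        32 * Real.exp (-Λ) * ∑ i ∈ Finset.range J, (S * (3⁻¹) ^ i) ^ p +
        4 * 5834 * Λ * ln / m * ∑ i ∈ Finset.range J, (S * (3⁻¹) ^ i) ^ p * 9 ^ i := by
      rw [Finset.mul_sum, Finset.mul_sum, ← Finset.sum_add_distrib]
      refine Finset.sum_le_sum fun i _ => ?_
      have h0 : 0 ≤ (S * (3⁻¹) ^ i) ^ p := by positivity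
      have h1 : 4 * L i / m ≤ 4 * (5834 * (9 ^ i * Λ) * ln) / m := by
        apply div_le_div_of_nonneg_right _ hm'.le
        linarith [hLup i]
      have h2 := mul_le_mul_of_nonneg_left h1 h0
      have e2 : (S * (3⁻¹) ^ i) ^ p * (4 * (5834 * (9 ^ i * Λ) * ln) / m) =
        4 * 5834 * Λ * ln / m * ((S * (3⁻¹) ^ i) ^ p * 9 ^ i) := by ring
      simp only [ε]
      rw [e2] at h2
      linarith
    have t1 : 32 * Real.exp (-Λ) * ∑ i ∈ Finset.range J, (S * (3⁻¹) ^ i) ^ p ≤ 1 / 8 := by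
      calc _ ≤ 32 * Real.exp (-Λ) * (2 * S ^ p) :=
            mul_le_mul_of_nonneg_left s1 (by positivity)
        _ = 1 / 8 := by
            rw [Real.exp_neg, hexpΛ]; field_simp; norm_num
    have t2 : 4 * 5834 * Λ * ln / m * ∑ i ∈ Finset.range J, (S * (3⁻¹) ^ i) ^ p * 9 ^ i ≤ 1 / 8 := by
      calc _ ≤ 4 * 5834 * Λ * ln / m * (S ^ p * (1 - ρ)⁻¹) :=
            mul_le_mul_of_nonneg_left s2 (by positivity)
        _ = (32 * 5834 * S ^ p * Λ * ln * (1 - ρ)⁻¹) / m / 8 := by ring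
        _ ≤ 1 / 8 := by
            apply div_le_div_of_nonneg_right _ (by norm_num)
            rw [div_le_one hm']; exact hbig
    linarith

section lp
variable {X : Type*} [MeasurableSpace X] {μ : Measure X} {p : ℝ}

lemma lp_eq (hp : 0 < p) {f : X → ℂ} (hf : MemLp f (ENNReal.ofReal p) μ) :
    lpNorm μ p f = (eLpNorm f (ENNReal.ofReal p) μ).toReal := by
  have h := hf.eLpNorm_eq_integral_rpow_norm (by simpa using hp) (by simp)
  rw [h, ENNReal.toReal_ofReal (by positivity), ENNReal.toReal_ofReal hp.le]
  simp [SamplingRecovery.lpNorm]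

lemma lp_nonneg (f : X → ℂ) : 0 ≤ lpNorm μ p f :=
  Real.rpow_nonneg (integral_nonneg fun x => by positivity) _

lemma lp_pow (hp : 0 < p) (f : X → ℂ) : lpNorm μ p f ^ p = ∫ x, ‖f x‖ ^ p ∂μ := by
  unfold SamplingRecovery.lpNorm
  rw [← Real.rpow_mul (integral_nonneg fun x => by positivity), one_div_mul_cancel hp.ne', Real.rpow_one]

lemma lp_add (hp : 1 ≤ p) {f h : X → ℂ} (hf : MemLp f (ENNReal.ofReal p) μ)
    (hh : MemLp h (ENNReal.ofReal p) μ) :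
    lpNorm μ p (f + h) ≤ lpNorm μ p f + lpNorm μ p h := by
  rw [lp_eq (by linarith) hf, lp_eq (by linarith) hh, lp_eq (by linarith) (hf.add hh),
    ← ENNReal.toReal_add hf.2.ne hh.2.ne]
  apply ENNReal.toReal_mono (ENNReal.add_ne_top.2 ⟨hf.2.ne, hh.2.ne⟩)
  apply eLpNorm_add_le hf.1 hh.1
  simpa using ENNReal.ofReal_le_ofReal hp

lemma lp_mono [IsProbabilityMeasure μ] (hp : 2 ≤ p) {f : X → ℂ}
    (hf : MemLp f (ENNReal.ofReal p) μ) : lpNorm μ 2 f ≤ lpNorm μ p f := by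
  have h2 : ENNReal.ofReal 2 ≤ ENNReal.ofReal p := ENNReal.ofReal_le_ofReal hp
  rw [lp_eq (by linarith) hf, lp_eq (by norm_num) (hf.mono_exponent h2)]
  exact ENNReal.toReal_mono hf.2.ne (eLpNorm_le_eLpNorm_of_exponent_le h2 hf.1)

lemma lp_smul (hp : 0 < p) (c : ℂ) (f : X → ℂ) :
    lpNorm μ p (fun x => c * f x) = ‖c‖ * lpNorm μ p f := by
  unfold SamplingRecovery.lpNorm
  simp only [norm_mul]
  have : ∀ x, (‖c‖ * ‖f x‖) ^ p = ‖c‖ ^ p * ‖f x‖ ^ p := fun x =>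
    Real.mul_rpow (norm_nonneg _) (norm_nonneg _)
  simp only [this]
  rw [integral_const_mul, Real.mul_rpow (by positivity) (integral_nonneg fun x => by positivity),
    ← Real.rpow_mul (norm_nonneg _), mul_one_div_cancel hp.ne', Real.rpow_one]

variable [IsProbabilityMeasure μ] {N : ℕ} {g : Fin N → X → ℂ}

lemma sum_memLp (hg : ∀ i, Measurable (g i))
    (hg1 : ∀ i x, ‖g i x‖ ≤ 1) (a : Fin N → ℂ) (q : ℝ≥0∞) :
    MemLp (fun x => ∑ i, a i * g i x) q μ := by
  refine MemLp.of_bound (Finset.measurable_sum _ (fun i _ => (hg i).const_mul _)).aestronglyMeasurable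
    (∑ i, ‖a i‖) (Filter.Eventually.of_forall fun x => ?_)
  refine (norm_sum_le _ _).trans (Finset.sum_le_sum fun i _ => ?_)
  rw [norm_mul]; nlinarith [hg1 i x, norm_nonneg (a i)]

lemma l1_bound (hg : ∀ i, Measurable (g i))
    (hg1 : ∀ i x, ‖g i x‖ ≤ 1) {R1 : ℝ} (hR : 0 < R1)
    (hRz : ∀ a : Fin N → ℂ,
      R1 * (∑ j, ‖a j‖ ^ 2) ^ (1 / 2 : ℝ) ≤ lpNorm μ 2 (fun x => ∑ j, a j * g j x))
    (hp : 2 ≤ p) (A : Finset (Fin N)) (a : Fin N → ℂ) :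
    ∑ i ∈ A, ‖a i‖ ≤ Real.sqrt A.card * R1⁻¹ * lpNorm μ p (fun x => ∑ j, a j * g j x) := by
  have h1 : ∑ i ∈ A, ‖a i‖ ≤ Real.sqrt A.card * Real.sqrt (∑ j, ‖a j‖ ^ 2) := by
    rw [← Real.sqrt_mul (by positivity)]
    apply Real.le_sqrt_of_sq_le
    refine (sq_sum_le_card_mul_sum_sq).trans ?_
    apply mul_le_mul_of_nonneg_left _ (by positivity)
    exact Finset.sum_le_sum_of_subset_of_nonneg (Finset.subset_univ _) (fun _ _ _ => by positivity)
  have h2 := (hRz a).trans (lp_mono hp (sum_memLp hg hg1 a _))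
  rw [← Real.sqrt_eq_rpow] at h2
  have h3 : Real.sqrt (∑ j, ‖a j‖ ^ 2) ≤ R1⁻¹ * lpNorm μ p (fun x => ∑ j, a j * g j x) := by
    rw [inv_mul_eq_div, le_div_iff₀ hR]; linarith
  rw [mul_assoc]
  exact h1.trans (mul_le_mul_of_nonneg_left h3 (Real.sqrt_nonneg _))

lemma disc_fixed (hg : ∀ i, Measurable (g i)) (hN : 1 ≤ N)
    (hg1 : ∀ i x, ‖g i x‖ ≤ 1) {R1 : ℝ} (hR : 0 < R1) (hR1 : R1 ≤ 1)
    (hRz : ∀ a : Fin N → ℂ,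
      R1 * (∑ j, ‖a j‖ ^ 2) ^ (1 / 2 : ℝ) ≤ lpNorm μ 2 (fun x => ∑ j, a j * g j x))
    (hp : 2 < p) {u : ℕ} (hu : 1 ≤ u) {S : ℝ} (hS : S = Real.sqrt (2 * u) * R1⁻¹) {m : ℕ} (hm : 0 < m)
    (hbig : 32 * 5834 * S ^ p * Real.log (512 * S ^ p) * Real.log (4 * N + 1) *
      (1 - 9 * 3 ^ (-p))⁻¹ ≤ m) :
    ∃ ξ : Fin m → X, ∀ (B : Finset (Fin N)) (a : Fin N → ℂ), B.card ≤ 2 * u →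
      (∀ i ∉ B, a i = 0) →
      lpNorm μ p (fun x => ∑ i, a i * g i x) ≤ 36 * dNorm ξ p (fun x => ∑ i, a i * g i x) := by
  have hu' : (1:ℝ) ≤ u := by exact_mod_cast hu
  have hS1 : 1 ≤ S := by
    rw [hS]
    have h1 : 1 ≤ Real.sqrt (2 * u) := by
      rw [Real.one_le_sqrt]; linarith
    have h2 : 1 ≤ R1⁻¹ := (one_le_inv₀ hR).2 hR1
    nlinarith
  have hp0 : 0 < p := by linarith
  obtain ⟨ξ, hξ⟩ := disc_points μ hm hN g hg hg1 hp hS1 hbig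
  refine ⟨ξ, fun B a hB ha => ?_⟩
  set f : X → ℂ := fun x => ∑ i, a i * g i x with hf
  have hI0 : 0 ≤ lpNorm μ p f := lp_nonneg f
  rcases hI0.eq_or_lt with h0 | hI
  · rw [← h0]; exact mul_nonneg (by norm_num) (dNorm_nonneg ξ f)
  set I := lpNorm μ p f with hIdef
  have efun : ∀ x, ∑ i, ((I⁻¹ : ℝ) : ℂ) * a i * g i x = ((I⁻¹ : ℝ) : ℂ) * f x := fun x => by
    rw [hf, Finset.mul_sum]; exact Finset.sum_congr rfl fun i _ => by ring
  have hcn : ‖((I⁻¹ : ℝ) : ℂ)‖ = I⁻¹ := by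
    rw [Complex.norm_real, Real.norm_of_nonneg (by positivity)]
  have hn1 : lpNorm μ p (fun x => ∑ i, ((I⁻¹ : ℝ) : ℂ) * a i * g i x) = 1 := by
    simp only [efun]
    rw [lp_smul hp0, hcn, ← hIdef]; field_simp
  have hl1 : ∑ i, ‖((I⁻¹ : ℝ) : ℂ) * a i‖ ≤ S := by
    have h := l1_bound hg hg1 hR hRz hp.le B (fun i => ((I⁻¹ : ℝ) : ℂ) * a i)
    rw [hn1, mul_one] at h
    have e : ∑ i, ‖((I⁻¹ : ℝ) : ℂ) * a i‖ = ∑ i ∈ B, ‖((I⁻¹ : ℝ) : ℂ) * a i‖ := by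
      symm
      apply Finset.sum_subset (Finset.subset_univ _)
      intro i _ hi
      rw [ha i hi]; simp
    rw [e]
    refine h.trans ?_
    rw [hS]
    apply mul_le_mul_of_nonneg_right _ (by positivity)
    apply Real.sqrt_le_sqrt
    exact_mod_cast hB
  have h := hξ _ hl1 (by rw [← lp_pow hp0, hn1, Real.one_rpow])
  simp only [efun] at h
  rw [← dNorm_pow ξ hp0 (fun x => ((I⁻¹ : ℝ) : ℂ) * f x)] at h
  have e2 : dNorm ξ p (fun x => ((I⁻¹ : ℝ) : ℂ) * f x) = I⁻¹ * dNorm ξ p f := by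
    have := dNorm_smul ξ hp0 ((I⁻¹ : ℝ) : ℂ) f
    rw [hcn] at this; exact this
  have hd0 := dNorm_nonneg ξ f (p := p)
  rw [e2, ← Real.mul_rpow (by norm_num) (by positivity)] at h
  have h2 : 1 ≤ 36 * (I⁻¹ * dNorm ξ p f) := by
    by_contra hc
    push Not at hc
    have := Real.rpow_lt_one (by positivity) hc hp0
    linarith
  have h3 := mul_le_mul_of_nonneg_left h2 hI.le
  have e3 : I * (36 * (I⁻¹ * dNorm ξ p f)) = 36 * dNorm ξ p f := by field_simp
  rw [e3] at h3; linarith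

end lp

/-- constant in the number of points -/
def Cd (p R1 : ℝ) : ℝ := 2 * (32 * 5834 * (2 ^ (p / 2) * R1⁻¹ ^ p) *
  (9 + p + 2 * p * Real.log R1⁻¹) * 4 * (1 - 9 * 3 ^ (-p))⁻¹)

lemma m_bound {p R1 : ℝ} (hp : 2 < p) (hR : 0 < R1) (hR1 : R1 ≤ 1) {N u : ℕ} (hN : 2 ≤ N)
    (hu : 1 ≤ u) (huN : u ≤ N) {S : ℝ} (hS : S = Real.sqrt (2 * u) * R1⁻¹) :
    ∃ m : ℕ, 0 < m ∧ 32 * 5834 * S ^ p * Real.log (512 * S ^ p) * Real.log (4 * N + 1) *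
      (1 - 9 * 3 ^ (-p))⁻¹ ≤ m ∧ (m:ℝ) ≤ Cd p R1 * (u:ℝ) ^ (p / 2) * (Real.log N) ^ 2 := by
  have hu' : (1:ℝ) ≤ u := by exact_mod_cast hu
  have hN' : (2:ℝ) ≤ N := by exact_mod_cast hN
  have huN' : (u:ℝ) ≤ N := by exact_mod_cast huN
  have hRi : 1 ≤ R1⁻¹ := (one_le_inv₀ hR).2 hR1
  have hS1 : 1 ≤ S := by
    rw [hS]
    have h1 : 1 ≤ Real.sqrt (2 * u) := by
      rw [Real.one_le_sqrt]; linarith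
    nlinarith
  have hS0 : 0 < S := by linarith
  have hSp : 1 ≤ S ^ p := Real.one_le_rpow hS1 (by linarith)
  have hSpe : S ^ p = 2 ^ (p / 2) * R1⁻¹ ^ p * (u:ℝ) ^ (p / 2) := by
    rw [hS, Real.mul_rpow (by positivity) (by positivity), Real.sqrt_eq_rpow,
      ← Real.rpow_mul (by positivity), Real.mul_rpow (by norm_num) (by positivity)]
    rw [show 1 / 2 * p = p / 2 by ring]; ring
  have hlN : Real.log 2 ≤ Real.log N := Real.log_le_log (by norm_num) hN'
  have hl2 := Real.log_two_gt_d9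
  have hlRi : 0 ≤ Real.log R1⁻¹ := Real.log_nonneg hRi
  have hln : Real.log (4 * N + 1) ≤ 4 * Real.log N := by
    have : 4 * Real.log N = Real.log ((N:ℝ) ^ 4) := by rw [Real.log_pow]; norm_num
    rw [this]
    apply Real.log_le_log (by positivity)
    have : (8:ℝ) ≤ (N:ℝ) ^ 3 := by
      calc (8:ℝ) = 2 ^ 3 := by norm_num
        _ ≤ (N:ℝ) ^ 3 := pow_le_pow_left₀ (by norm_num) hN' 3
    nlinarith
  have hln1 : 1 ≤ Real.log (4 * N + 1) := by
    rw [Real.le_log_iff_exp_le (by positivity)]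
    have := Real.exp_one_lt_d9
    linarith
  have hSN : S ≤ N * R1⁻¹ := by
    rw [hS]
    apply mul_le_mul_of_nonneg_right _ (by positivity)
    rw [Real.sqrt_le_left (by positivity)]
    nlinarith
  have hΛ : Real.log (512 * S ^ p) ≤ (9 + p + 2 * p * Real.log R1⁻¹) * Real.log N := by
    rw [Real.log_mul (by norm_num) (by positivity), Real.log_rpow hS0]
    have h1 : Real.log 512 = 9 * Real.log 2 := by
      rw [show (512:ℝ) = 2 ^ 9 by norm_num, Real.log_pow]; norm_num
    have h2 : Real.log S ≤ Real.log N + Real.log R1⁻¹ := by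
      rw [← Real.log_mul (by positivity) (by positivity)]
      exact Real.log_le_log hS0 hSN
    have h3 : p * Real.log S ≤ p * (Real.log N + Real.log R1⁻¹) :=
      mul_le_mul_of_nonneg_left h2 (by linarith)
    have h4 : 0 ≤ p * Real.log R1⁻¹ := mul_nonneg (by linarith) hlRi
    have h5 : p * Real.log R1⁻¹ * 1 ≤ p * Real.log R1⁻¹ * (2 * Real.log N) :=
      mul_le_mul_of_nonneg_left (by linarith) h4
    rw [h1]
    linarith
  have hΛ1 : 1 ≤ Real.log (512 * S ^ p) := by
    rw [Real.le_log_iff_exp_le (by positivity)]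
    have := Real.exp_one_lt_d9
    linarith
  have hρ1 : (9:ℝ) * 3 ^ (-p) < 1 := by
    have : (3:ℝ) ^ (-p) < 3 ^ (-2:ℝ) := Real.rpow_lt_rpow_of_exponent_lt (by norm_num) (by linarith)
    have e : (3:ℝ) ^ (-2:ℝ) = 1 / 9 := by
      rw [Real.rpow_neg (by norm_num)]; norm_num
    rw [e] at this; linarith
  have hρ0 : (0:ℝ) < 9 * 3 ^ (-p) := by positivity
  have hZ : 1 ≤ (1 - (9:ℝ) * 3 ^ (-p))⁻¹ := (one_le_inv₀ (by linarith)).2 (by linarith)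
  set Z := (1 - (9:ℝ) * 3 ^ (-p))⁻¹ with hZdef
  set M := 32 * 5834 * S ^ p * Real.log (512 * S ^ p) * Real.log (4 * N + 1) * Z with hM
  have hM1 : 1 ≤ M := by
    have a1 : 1 ≤ 32 * 5834 * S ^ p := by linarith
    have a2 := one_le_mul_of_one_le_of_one_le a1 hΛ1
    have a3 := one_le_mul_of_one_le_of_one_le a2 hln1
    exact one_le_mul_of_one_le_of_one_le a3 hZ
  refine ⟨⌈M⌉₊, Nat.ceil_pos.2 (by linarith), Nat.le_ceil _, ?_⟩
  have hc := Nat.ceil_lt_add_one (show 0 ≤ M by linarith)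
  have hMle : M ≤ 32 * 5834 * S ^ p * ((9 + p + 2 * p * Real.log R1⁻¹) * Real.log N) *
      (4 * Real.log N) * Z := by
    rw [hM]
    gcongr
  have e : 2 * (32 * 5834 * S ^ p * ((9 + p + 2 * p * Real.log R1⁻¹) * Real.log N) *
      (4 * Real.log N) * Z) = Cd p R1 * (u:ℝ) ^ (p / 2) * (Real.log N) ^ 2 := by
    rw [hSpe, Cd, ← hZdef]; ring
  linarith

/-- the constant in the number of iterations -/
def cc (t p : ℝ) : ℝ := 1 + 400000 * (p + 1) ^ 2 / t ^ 2

lemma u_num {p t R1 : ℝ} (hp : 2 < p) (ht : 0 < t) (hR : 0 < R1) (hR1 : R1 ≤ 1) {v : ℕ}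
    (hv : 0 < v) :
    2 * v ≤ uRiesz (cc t p) R1 v ∧ ∃ K : ℕ,
      Real.exp (-(t ^ 2 / (36 * (p + 1) ^ 2 * (36 * R1⁻¹) ^ 2)) * K / 2) *
        (5 * (36 * R1⁻¹) * Real.sqrt v) ≤ 1 ∧ 2 * K * v ≤ uRiesz (cc t p) R1 v := by
  have hv' : (1:ℝ) ≤ v := by exact_mod_cast hv
  have hρ : 1 ≤ R1⁻¹ := (one_le_inv₀ hR).2 hR1
  set ρ := R1⁻¹ with hρdef
  have hγ : 0 < (p + 1) ^ 2 := by positivity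
  set γ := (p + 1) ^ 2 with hγdef
  have hρv : 1 ≤ ρ * v := one_le_mul_of_one_le_of_one_le hρ hv'
  set l := Real.log (2 * ρ * v) with hl
  have hl2 : Real.log 2 ≤ l := Real.log_le_log (by norm_num) (by nlinarith)
  have hl2' := Real.log_two_gt_d9
  have hl0 : 0 < l := by linarith
  have hρ2 : 1 ≤ ρ ^ 2 := one_le_pow₀ hρ
  set w := γ * ρ ^ 2 / t ^ 2 * l with hw
  have hw0 : 0 ≤ w := by positivity
  have e1 : cc t p * (2 * ρ) ^ 2 * l = 4 * ρ ^ 2 * l + 1600000 * w := by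
    rw [cc, ← hγdef, hw]; ring
  have h41 : 1 ≤ 4 * ρ ^ 2 * l := by nlinarith
  have hu : (1 + cc t p * (2 * ρ) ^ 2 * l) * v ≤ uRiesz (cc t p) R1 v := Nat.le_ceil _
  rw [e1] at hu
  refine ⟨?_, ⌈93312 * γ * ρ ^ 2 / t ^ 2 * Real.log (5 * (36 * ρ) * Real.sqrt v)⌉₊, ?_, ?_⟩
  · have : (2 * v : ℝ) ≤ uRiesz (cc t p) R1 v := by
      refine le_trans ?_ hu
      apply mul_le_mul_of_nonneg_right _ (by linarith); linarith
    exact_mod_cast this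
  · set Y := 5 * (36 * ρ) * Real.sqrt v with hY
    have hY0 : 0 < Y := by positivity
    set K := ⌈93312 * γ * ρ ^ 2 / t ^ 2 * Real.log Y⌉₊ with hK
    have hKl : 93312 * γ * ρ ^ 2 / t ^ 2 * Real.log Y ≤ K := Nat.le_ceil _
    have h1 : Real.log Y ≤ (t ^ 2 / (36 * γ * (36 * ρ) ^ 2)) * K / 2 := by
      have e : Real.log Y = (t ^ 2 / (36 * γ * (36 * ρ) ^ 2)) *
          (93312 * γ * ρ ^ 2 / t ^ 2 * Real.log Y) / 2 := by
        field_simp; ring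
      rw [e]
      have : 0 ≤ t ^ 2 / (36 * γ * (36 * ρ) ^ 2) := by positivity
      have := mul_le_mul_of_nonneg_left hKl this
      linarith
    have h2 : Y ≤ Real.exp ((t ^ 2 / (36 * γ * (36 * ρ) ^ 2)) * K / 2) := by
      rwa [← Real.log_le_iff_le_exp hY0]
    rw [show -(t ^ 2 / (36 * γ * (36 * ρ) ^ 2)) * K / 2 = -((t ^ 2 / (36 * γ * (36 * ρ) ^ 2)) * K / 2) by ring,
      Real.exp_neg, inv_mul_eq_div, div_le_one (Real.exp_pos _)]
    exact h2
  · set Y := 5 * (36 * ρ) * Real.sqrt v with hY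
    have hsv : 1 ≤ Real.sqrt v := by rw [Real.one_le_sqrt]; exact hv'
    have hY1 : 1 ≤ Y := by rw [hY]; nlinarith
    have hlY : 0 ≤ Real.log Y := Real.log_nonneg hY1
    have hlY8 : Real.log Y ≤ 8 * l := by
      have e : 8 * l = Real.log ((2 * ρ * v) ^ 8) := by rw [Real.log_pow]; norm_num [hl]
      rw [e]
      apply Real.log_le_log (by linarith)
      have hsv2 : Real.sqrt v ≤ v := by
        rw [Real.sqrt_le_left (by linarith)]; nlinarith
      have h1 : Y ≤ 180 * (ρ * v) := by
        rw [hY]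
        have := mul_le_mul_of_nonneg_left hsv2 (show 0 ≤ ρ by linarith)
        linarith
      have h2 : (ρ * v) ≤ (ρ * v) ^ 8 := le_self_pow₀ hρv (by norm_num)
      have h3 : (2 * ρ * v) ^ 8 = 256 * (ρ * v) ^ 8 := by ring
      rw [h3]; linarith
    set K := ⌈93312 * γ * ρ ^ 2 / t ^ 2 * Real.log Y⌉₊ with hK
    have hKu : (K:ℝ) < 93312 * γ * ρ ^ 2 / t ^ 2 * Real.log Y + 1 :=
      Nat.ceil_lt_add_one (by positivity)
    have h5 : 93312 * γ * ρ ^ 2 / t ^ 2 * Real.log Y ≤ 93312 * γ * ρ ^ 2 / t ^ 2 * (8 * l) :=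
      mul_le_mul_of_nonneg_left hlY8 (by positivity)
    have e5 : 93312 * γ * ρ ^ 2 / t ^ 2 * (8 * l) = 746496 * w := by rw [hw]; ring
    have : (2 * K * v : ℝ) ≤ uRiesz (cc t p) R1 v := by
      refine le_trans ?_ hu
      apply mul_le_mul_of_nonneg_right _ (by linarith); linarith
    exact_mod_cast this

lemma R1_le_one {X : Type*} [MeasurableSpace X] {μ : Measure X} [IsProbabilityMeasure μ]
    {N : ℕ} {g : Fin N → X → ℂ} (hg1 : ∀ i x, ‖g i x‖ ≤ 1) {R1 : ℝ}
    (hRz : ∀ a : Fin N → ℂ,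
      R1 * (∑ j, ‖a j‖ ^ 2) ^ (1 / 2 : ℝ) ≤ lpNorm μ 2 (fun x => ∑ j, a j * g j x))
    (i : Fin N) : R1 ≤ 1 := by
  have h := hRz (Pi.single i 1)
  have e1 : ∑ j, ‖(Pi.single i 1 : Fin N → ℂ) j‖ ^ 2 = 1 := by
    rw [Finset.sum_eq_single i] <;> simp +contextual [Pi.single_apply]
  have e2 : (fun x => ∑ j, (Pi.single i 1 : Fin N → ℂ) j * g j x) = g i := by
    funext x
    rw [Finset.sum_eq_single i] <;> simp +contextual [Pi.single_apply]
  rw [e1, e2, Real.one_rpow, mul_one] at h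
  refine h.trans ?_
  unfold SamplingRecovery.lpNorm
  apply Real.rpow_le_one (integral_nonneg fun x => by positivity) _ (by norm_num)
  calc ∫ x, ‖g i x‖ ^ (2:ℝ) ∂μ ≤ ∫ x, (1:ℝ) ∂μ :=
        integral_mono_of_nonneg (Filter.Eventually.of_forall fun x => by positivity)
          (integrable_const _) (Filter.Eventually.of_forall fun x =>
            Real.rpow_le_one (norm_nonneg _) (hg1 i x) (by norm_num))
    _ = 1 := by simp

lemma sample_bound {X : Type*} [MeasurableSpace X] [MeasurableSingletonClass X]
    {μ : Measure X} [IsProbabilityMeasure μ] {m : ℕ} (hm : 0 < m) (ξ : Fin m → X) {p : ℝ}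
    (hp : 2 < p) (F : X → ℂ) (hF : Measurable F) {C : ℝ} (hC : ∀ x, ‖F x‖ ≤ C) :
    lpNorm μ p F ≤ 2 * lpNorm (sampleMeasure μ ξ) p F ∧
    dNorm ξ p F ≤ 2 * lpNorm (sampleMeasure μ ξ) p F := by
  have hp0 : 0 < p := by linarith
  have hm' : (0:ℝ) < m := by exact_mod_cast hm
  have hint : ∀ ν : Measure X, IsFiniteMeasure ν → Integrable (fun x => ‖F x‖ ^ p) ν := by
    intro ν hν
    refine Integrable.of_bound (hF.norm.pow_const p).aestronglyMeasurable (C ^ p)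
      (Filter.Eventually.of_forall fun x => ?_)
    rw [Real.norm_of_nonneg (by positivity)]
    exact Real.rpow_le_rpow (norm_nonneg _) (hC x) hp0.le
  have hfin : (2 * (m:ℝ≥0∞))⁻¹ ≠ ⊤ := by
    simp [hm.ne']
  have e : ∫ x, ‖F x‖ ^ p ∂(sampleMeasure μ ξ) =
      1 / 2 * lpNorm μ p F ^ p + 1 / 2 * dNorm ξ p F ^ p := by
    unfold sampleMeasure
    rw [integral_add_measure ((hint μ inferInstance).smul_measure (by simp))
      ((integrable_finsetSum_measure.2 fun j _ => hint _ inferInstance).smul_measure hfin),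
      integral_smul_measure, integral_smul_measure,
      integral_finsetSum_measure (fun j _ => hint _ inferInstance)]
    simp only [integral_dirac]
    rw [lp_pow hp0, dNorm_pow ξ hp0]
    simp only [smul_eq_mul, ENNReal.toReal_inv, ENNReal.toReal_mul, ENNReal.toReal_natCast,
      ENNReal.toReal_ofNat, ENNReal.toReal_div, ENNReal.toReal_one, mul_inv]
    ring
  set L := lpNorm (sampleMeasure μ ξ) p F with hL
  have hL0 : 0 ≤ L := lp_nonneg F
  rw [← lp_pow hp0, ← hL] at e
  have h0 : 0 ≤ lpNorm μ p F := lp_nonneg F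
  have h1 := dNorm_nonneg ξ F (p := p)
  have h0' : 0 ≤ lpNorm μ p F ^ p := Real.rpow_nonneg h0 _
  have h1' : 0 ≤ dNorm ξ p F ^ p := Real.rpow_nonneg h1 _
  have h2 : 2 * L ^ p ≤ (2 * L) ^ p := by
    rw [Real.mul_rpow (by norm_num) hL0]
    apply mul_le_mul_of_nonneg_right _ (by positivity)
    exact Real.self_le_rpow_of_one_le (by norm_num) (by linarith)
  constructor
  · exact (Real.rpow_le_rpow_iff h0 (by positivity) hp0).1 (by linarith)
  · exact (Real.rpow_le_rpow_iff h1 (by positivity) hp0).1 (by linarith)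

lemma main_est {X : Type*} [MeasurableSpace X] [MeasurableSingletonClass X]
    {μ : Measure X} [IsProbabilityMeasure μ] {N : ℕ} {g : Fin N → X → ℂ}
    (hg : ∀ i, Measurable (g i)) (hg1 : ∀ i x, ‖g i x‖ ≤ 1) {R1 : ℝ} (hR : 0 < R1) (hR1 : R1 ≤ 1)
    (hRz : ∀ a : Fin N → ℂ,
      R1 * (∑ j, ‖a j‖ ^ 2) ^ (1 / 2 : ℝ) ≤ lpNorm μ 2 (fun x => ∑ j, a j * g j x))
    {p t : ℝ} (hp : 2 < p) (ht : 0 < t) {v u K : ℕ} (hv : 0 < v) (hvu : v ≤ u)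
    (hK : Real.exp (-(t ^ 2 / (36 * (p + 1) ^ 2 * (36 * R1⁻¹) ^ 2)) * K / 2) *
        (5 * (36 * R1⁻¹) * Real.sqrt v) ≤ 1) (hKu : 2 * K * v ≤ u)
    {m : ℕ} (hm : 0 < m) (ξ : Fin m → X)
    (hdisc : ∀ (B : Finset (Fin N)) (a : Fin N → ℂ), B.card ≤ 2 * u →
      (∀ i ∉ B, a i = 0) →
      lpNorm μ p (fun x => ∑ i, a i * g i x) ≤ 36 * dNorm ξ p (fun x => ∑ i, a i * g i x))
    {f0 : X → ℂ} (hf0 : Measurable f0) {C : ℝ} (hC : ∀ x, ‖f0 x‖ ≤ C)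
    {φ : ℕ → Fin N} {G : ℕ → X → ℂ} (hW : IsWCGA g (dNorm ξ p) t f0 φ G)
    (T : Finset (Fin N)) (hT : T.card ≤ v) (a : Fin N → ℂ) :
    lpNorm μ p (f0 - G u) ≤
      218 * lpNorm (sampleMeasure μ ξ) p (f0 - fun x => ∑ i ∈ T, a i * g i x) := by
  have hp0 : 0 < p := by linarith
  have hm' : (0:ℝ) < m := by exact_mod_cast hm
  have hρ : 1 ≤ R1⁻¹ := (one_le_inv₀ hR).2 hR1
  have hsumB : ∀ (B : Finset (Fin N)) (c : Fin N → ℂ),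
      (∑ i ∈ B, c i • g i) = fun x => ∑ i, (if i ∈ B then c i else 0) * g i x := by
    intro B c
    funext x
    rw [Finset.sum_apply]
    simp only [Pi.smul_apply, smul_eq_mul, ite_mul, zero_mul]
    rw [Finset.sum_ite_mem, Finset.univ_inter]
  have hgd : ∀ i, dNorm ξ p (g i) ≤ 1 := by
    intro i
    unfold dNorm
    apply Real.rpow_le_one (by positivity) _ (by positivity)
    rw [inv_mul_le_iff₀ hm', mul_one]
    calc _ ≤ ∑ j : Fin m, (1:ℝ) := Finset.sum_le_sum fun j _ =>
          Real.rpow_le_one (norm_nonneg _) (hg1 i _) hp0.le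
      _ = m := by simp
  have hinc : ∀ (A B : Finset (Fin N)), A ⊆ B → B.card ≤ T.card + u → ∀ c : Fin N → ℂ,
      ∑ i ∈ A, ‖c i‖ ≤ 36 * R1⁻¹ * Real.sqrt A.card * dNorm ξ p (∑ i ∈ B, c i • g i) := by
    intro A B hAB hB c
    rw [hsumB]
    have h1 := l1_bound hg hg1 hR hRz hp.le A (fun i => if i ∈ B then c i else 0)
    have e1 : ∑ i ∈ A, ‖if i ∈ B then c i else 0‖ = ∑ i ∈ A, ‖c i‖ :=
      Finset.sum_congr rfl fun i hi => by rw [if_pos (hAB hi)]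
    rw [e1] at h1
    have h2 := hdisc B (fun i => if i ∈ B then c i else 0) (by omega) (fun i hi => if_neg hi)
    have h3 := mul_le_mul_of_nonneg_left h2 (show 0 ≤ Real.sqrt A.card * R1⁻¹ by positivity)
    linarith
  have hw := wcga_main (a := a) (γ := (p + 1) ^ 2) (V := 36 * R1⁻¹) (by positivity) ht (by linarith)
    (dNorm_add ξ (by linarith)) (dNorm_nonneg ξ) (dNorm_smul ξ hp0) hgd
    (fun x y hx => dNorm_smooth ξ hp x y hx) hinc hW v hv hT K hK hKu
  obtain ⟨c, hc, hGc⟩ := mem_spn_iff_sum (G_mem hW u)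
  set h : X → ℂ := ∑ i ∈ T, a i • g i with hh
  have eh : (fun x => ∑ i ∈ T, a i * g i x) = h := by
    rw [hh]; funext x; simp
  rw [eh]
  set a' : Fin N → ℂ := fun i => (if i ∈ T then a i else 0) - (if i ∈ Gam φ u then c i else 0) with ha'
  have ehG : h - G u = fun x => ∑ i, a' i * g i x := by
    rw [hh, hGc, hsumB, hsumB]
    funext x
    simp only [Pi.sub_apply, ha', sub_mul, Finset.sum_sub_distrib]
  have hcard : (T ∪ Gam φ u).card ≤ 2 * u := by
    have h1 := Finset.card_union_le T (Gam φ u)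
    have h2 := Gam_card φ u
    omega
  have hd := hdisc (T ∪ Gam φ u) a' hcard (by
    intro i hi
    rw [Finset.mem_union, not_or] at hi
    simp [ha', hi.1, hi.2])
  rw [← ehG] at hd
  have ehm : h = fun x => ∑ i, (if i ∈ T then a i else 0) * g i x := hsumB T a
  have hmeas : Measurable h := by
    rw [ehm]; exact Finset.measurable_sum _ (fun i _ => (hg i).const_mul _)
  have hF : Measurable (f0 - h) := hf0.sub hmeas
  have hb : ∀ x, ‖(f0 - h) x‖ ≤ C + ∑ i, ‖if i ∈ T then a i else 0‖ := by
    intro x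
    rw [Pi.sub_apply]
    refine (norm_sub_le _ _).trans (add_le_add (hC x) ?_)
    rw [ehm]
    refine (norm_sum_le _ _).trans (Finset.sum_le_sum fun i _ => ?_)
    rw [norm_mul]; nlinarith [hg1 i x, norm_nonneg (if i ∈ T then a i else 0)]
  obtain ⟨s1, s2⟩ := sample_bound (μ := μ) hm ξ hp (f0 - h) hF hb
  have m1 : MemLp (f0 - h) (ENNReal.ofReal p) μ :=
    MemLp.of_bound hF.aestronglyMeasurable _ (Filter.Eventually.of_forall hb)
  have m2 : MemLp (h - G u) (ENNReal.ofReal p) μ := by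
    rw [ehG]; exact sum_memLp hg hg1 a' _
  have t1 := lp_add (by linarith) m1 m2
  rw [sub_add_sub_cancel] at t1
  have t2 : dNorm ξ p (h - G u) ≤ dNorm ξ p (f0 - h) + dNorm ξ p (f0 - G u) := by
    have e : h - G u = (-1 : ℂ) • (f0 - h) + (f0 - G u) := by
      funext x; simp
    have := dNorm_add ξ (p := p) (by linarith) ((-1 : ℂ) • (f0 - h)) (f0 - G u)
    rw [← e, dNorm_smul ξ hp0] at this
    simpa using this
  linarith

end WR

open WR

/-- under the hypotheses of the WCGA recovery theorem for uniformly bounded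
Riesz systems (`2 < p < ∞`), the residual after `u` iterations satisfies
`‖f_u‖_{L_p(Ω,μ)} ≤ C' σ_v(f_0, D_N)_{L_p(Ω,μ_ξ)}` with `μ_ξ = (μ + μ_m)/2` and `C'` a
positive absolute constant. -/
theorem wcga_riesz_recovery_sampleMeasure :
    ∃ C' : ℝ, 0 < C' ∧
    ∃ c : ℝ → ℝ → ℝ, (∀ t p, 1 ≤ c t p) ∧
    ∃ Cc : ℝ → ℝ → ℝ → ℝ,
    ∀ p t : ℝ, 2 < p → 0 < t → t ≤ 1 →
    ∀ R1 R2 : ℝ, 0 < R1 → R1 ≤ R2 →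
    ∀ (d : ℕ) (Ω : Set (Fin d → ℝ)), IsCompact Ω →
    ∀ μ : Measure Ω, IsProbabilityMeasure μ →
    ∀ (N : ℕ) (g : Fin N → Ω → ℂ), (∀ i, Continuous (g i)) →
      (∀ i x, ‖g i x‖ ≤ 1) →
      (∀ a : Fin N → ℂ,
        R1 * (∑ j, ‖a j‖ ^ 2) ^ (1 / 2 : ℝ) ≤ lpNorm μ 2 (fun x => ∑ j, a j * g j x) ∧
        lpNorm μ 2 (fun x => ∑ j, a j * g j x) ≤ R2 * (∑ j, ‖a j‖ ^ 2) ^ (1 / 2 : ℝ)) →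
    ∀ v : ℕ, 0 < v → uRiesz (c t p) R1 v ≤ N →
    ∃ (m : ℕ) (ξ : Fin m → Ω),
      (m : ℝ) ≤ Cc p R1 R2 * (uRiesz (c t p) R1 v : ℝ) ^ (p / 2) * (Real.log N) ^ 2 ∧
      ∀ f0 : Ω → ℂ, Continuous f0 →
      ∀ (φ : ℕ → Fin N) (G : ℕ → Ω → ℂ),
        IsWCGA g (dNorm ξ p) t f0 φ G →
        lpNorm μ p (f0 - G (uRiesz (c t p) R1 v)) ≤
          C' * sigmaErr (lpNorm (sampleMeasure μ ξ) p) g v f0 := by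

  refine ⟨218, by norm_num, cc, ?_, fun p R1 _ => Cd p R1, ?_⟩
  · intro t p
    have : 0 ≤ 400000 * (p + 1) ^ 2 / t ^ 2 := by positivity
    unfold cc; linarith
  intro p t hp ht ht1 R1 R2 hR hR12 d Ω hΩ μ hμ N g hgc hg1 hRz v hv huN
  have hg : ∀ i, Measurable (g i) := fun i => (hgc i).measurable
  haveI : CompactSpace Ω := isCompact_iff_compactSpace.1 hΩ
  rcases Nat.eq_zero_or_pos N with hN | hN
  · subst hN
    refine ⟨0, Fin.elim0, ?_, ?_⟩
    · have h0 : uRiesz (cc t p) R1 v = 0 := Nat.le_zero.1 huN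
      simp
    · intro f0 _ φ
      exact (φ 0).elim0
  have hR1 : R1 ≤ 1 := R1_le_one hg1 (fun a => (hRz a).1) ⟨0, hN⟩
  obtain ⟨h2v, K, hK, hKu⟩ := u_num hp ht hR hR1 hv
  set u := uRiesz (cc t p) R1 v with hu
  obtain ⟨m, hm, hbig, hmle⟩ := m_bound hp hR hR1 (N := N) (u := u) (by omega) (by omega) huN rfl
  obtain ⟨ξ, hξ⟩ := disc_fixed hg hN hg1 hR hR1 (fun a => (hRz a).1) hp (u := u) (by omega) rfl hm hbig
  refine ⟨m, ξ, hmle, fun f0 hf0 φ G hW => ?_⟩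
  obtain ⟨C, hC⟩ : ∃ C : ℝ, ∀ x, ‖f0 x‖ ≤ C := by
    obtain ⟨C, hC⟩ := isCompact_univ.exists_bound_of_continuousOn hf0.continuousOn
    exact ⟨C, fun x => hC x (Set.mem_univ x)⟩
  rw [← div_le_iff₀' (by norm_num)]
  unfold sigmaErr
  refine le_csInf ?_ ?_
  · exact ⟨_, _, ⟨∅, 0, by simp, rfl⟩, rfl⟩
  · rintro _ ⟨_, ⟨T, a, hT, rfl⟩, rfl⟩
    rw [div_le_iff₀' (by norm_num)]
    exact main_est hg hg1 hR hR1 (fun a => (hRz a).1) hp ht hv (by omega) hK hKu hm ξ hξ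
      hf0.measurable hC hW T hT a
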